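/- Let s > 2d and let V : ℝ^d → ℝ be a bounded continuous function with finite M^∞_s norm, i.e. sup_{(x,ξ) ∈ ℝ^{2d}} ⟨ξ⟩^s |V_g V(x,ξ)| < ∞. For t ∈ ℝ, t ≠ 0, and n ≥ 1 let E_n(t) = ( U₀(t/n) ∘ M_{t/n} )^n and let U(t)φ = lim_{n→∞} E_n(t)φ in L²(ℝ^d) (the Trotter limit). Then: (1) for each n there is a continuous function e_{n,t} : ℝ^d × ℝ^d → ℂ such that E_n(t)φ(x) = ∫_{ℝ^d} e_{n,t}(x,y) φ(y) dy for a.e. x, for every φ ∈ 𝓢(ℝ^d); (2) the functions a_{n,t}(x,y) := e^{−i|x−y|²/(2t)} e_{n,t}(x,y) satisfy sup_{n ≥ 1} sup_{(u,ζ) ∈ ℝ^{4d}} ⟨ζ⟩^s |V_G a_{n,t}(u,ζ)| < ∞ (uniform boundedness in M^∞_s(ℝ^{2d})); (3) there is a continuous bounded-modulus... function u_t : ℝ^d × ℝ^d → ℂ such that e_{n,t} → u_t uniformly on every compact subset of ℝ^{2d}, and U(t)φ(x) = ∫_{ℝ^d} u_t(x,y) φ(y) dy for a.e. x, for every φ ∈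 𝓢(ℝ^d). -/

import Mathlib

open MeasureTheory Real Filter Topology
open scoped RealInnerProductSpace ENNReal NNReal

noncomputable section

/-- Euclidean space `ℝ^d`. -/
abbrev Euc (d : ℕ) := EuclideanSpace ℝ (Fin d)

/-- `L²(ℝ^d)`. -/
abbrev L2Sp (d : ℕ) := Lp ℂ 2 (volume : Measure (Euc d))

/-- The Gaussian window `g(t) = e^{-π|t|²}` on `ℝ^d`. -/
def gaussWindow {d : ℕ} (t : Euc d) : ℂ := (Real.exp (-π * ‖t‖ ^ 2) : ℝ)

/-- The short-time Fourier transform on `ℝ^d` with Gaussian window: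
`V_g f(x,ξ) = ∫ e^{-2πi ξ·t} f(t) g(t-x) dt`. -/
def STFT {d : ℕ} (f : Euc d → ℂ) (x ξ : Euc d) : ℂ :=
  ∫ (t : Euc d),
    Complex.exp (-(((2 * π * ⟪ξ, t⟫ : ℝ) : ℂ) * Complex.I)) * f t * gaussWindow (t - x)

/-- The Gaussian window `G(u) = e^{-π|u|²}` on `ℝ^{2d} = ℝ^d × ℝ^d`. -/
def gaussWindow2 {d : ℕ} (u : Euc d × Euc d) : ℂ :=
  (Real.exp (-π * (‖u.1‖ ^ 2 + ‖u.2‖ ^ 2)) : ℝ)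

/-- The short-time Fourier transform on `ℝ^{2d} = ℝ^d × ℝ^d` with Gaussian window. -/
def STFT2 {d : ℕ} (f : Euc d × Euc d → ℂ) (u ζ : Euc d × Euc d) : ℂ :=
  ∫ (v : Euc d × Euc d),
    Complex.exp (-(((2 * π * (⟪ζ.1, v.1⟫ + ⟪ζ.2, v.2⟫) : ℝ) : ℂ) * Complex.I)) * f v *
      gaussWindow2 (v - u)

/-- The polynomial weight `(1 + ‖z‖)^{-s}`. -/
def wt (s : ℝ) {E : Type*} [NormedAddCommGroup E] (z : E) : ℝ := (1 + ‖z‖) ^ (-s)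

section Weight

variable {E : Type*} [NormedAddCommGroup E] {s : ℝ}

lemma one_add_norm_pos (z : E) : 0 < 1 + ‖z‖ := by positivity

lemma wt_pos (s : ℝ) (z : E) : 0 < wt s z := Real.rpow_pos_of_pos (one_add_norm_pos z) _

lemma wt_nonneg (s : ℝ) (z : E) : 0 ≤ wt s z := (wt_pos s z).le

lemma wt_neg (s : ℝ) (z : E) : wt s (-z) = wt s z := by simp [wt]

lemma wt_sub_comm (s : ℝ) (z w : E) : wt s (z - w) = wt s (w - z) := by
  rw [← wt_neg, neg_sub]

lemma continuous_wt (s : ℝ) : Continuous (wt s : E → ℝ) :=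
  (continuous_const.add continuous_norm).rpow_const fun z => Or.inl (one_add_norm_pos z).ne'

lemma wt_le_of_le {F : Type*} [NormedAddCommGroup F] (hs : 0 ≤ s) {c : ℝ} (hc : 0 ≤ c) {a : E} {b : F}
    (h : 1 + ‖a‖ ≤ c * (1 + ‖b‖)) : wt s b ≤ c ^ s * wt s a := by
  have ha := one_add_norm_pos a
  have hb := one_add_norm_pos b
  have h1 : (1 + ‖a‖) ^ s ≤ c ^ s * (1 + ‖b‖) ^ s := by
    rw [← Real.mul_rpow hc hb.le]
    exact Real.rpow_le_rpow ha.le h hs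
  unfold wt
  rw [Real.rpow_neg ha.le, Real.rpow_neg hb.le, ← div_eq_mul_inv,
    le_div_iff₀ (Real.rpow_pos_of_pos ha s), inv_mul_le_iff₀ (Real.rpow_pos_of_pos hb s), mul_comm]
  exact h1

lemma wt_mul_wt_le (hs : 0 ≤ s) (z w a : E) :
    wt s (a - z) * wt s (a - w) ≤ 2 ^ s * wt s (w - z) * (wt s (a - z) + wt s (a - w)) := by
  have htri : ‖w - z‖ ≤ ‖a - z‖ + ‖a - w‖ := by
    have := norm_sub_le (a - z) (a - w)
    rwa [sub_sub_sub_cancel_left] at this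
  have h0 := wt_nonneg s (a - z)
  have h1 := wt_nonneg s (a - w)
  have h2 : 0 ≤ 2 ^ s * wt s (w - z) := mul_nonneg (by positivity) (wt_nonneg _ _)
  rcases le_total ‖a - z‖ ‖a - w‖ with h | h
  · have := wt_le_of_le (s := s) (a := w - z) (b := a - w) hs (c := 2) (by norm_num) (by linarith)
    nlinarith [mul_le_mul_of_nonneg_left this h0, mul_nonneg h2 h1]
  · have := wt_le_of_le (s := s) (a := w - z) (b := a - z) hs (c := 2) (by norm_num) (by linarith)
    nlinarith [mul_le_mul_of_nonneg_right this h1, mul_nonneg h2 h0]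

lemma exp_neg_mul_sq_le {c : ℝ} (hc : 0 < c) (N : ℝ) {r : ℝ} (hr : 0 ≤ r) (hN : 0 ≤ N) :
    Real.exp (-c * r ^ 2) ≤ Real.exp (N ^ 2 / (4 * c)) * (1 + r) ^ (-N) := by
  have h1 : (1 + r) ^ (-N) = Real.exp (Real.log (1 + r) * (-N)) :=
    Real.rpow_def_of_pos (by linarith) _
  rw [h1, ← Real.exp_add, Real.exp_le_exp]
  have h2 : Real.log (1 + r) ≤ r := by
    have := Real.log_le_sub_one_of_pos (show 0 < 1 + r by linarith)
    linarith
  have h3 : N * r ≤ c * r ^ 2 + N ^ 2 / (4 * c) := by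
    have : c * r ^ 2 + N ^ 2 / (4 * c) - N * r = c * (r - N / (2 * c)) ^ 2 := by
      field_simp
      ring
    nlinarith [mul_nonneg hc.le (sq_nonneg (r - N / (2 * c)))]
  nlinarith

lemma wt_prod_le {F : Type*} [NormedAddCommGroup F] (hs : 0 ≤ s) (z : E × F) :
    wt s z ≤ wt (s / 2) z.1 * wt (s / 2) z.2 := by
  have h : wt s z = wt (s / 2) z * wt (s / 2) z := by
    unfold wt
    rw [← Real.rpow_add (one_add_norm_pos z)]
    congr 1
    ring
  have h1 : wt (s / 2) z ≤ wt (s / 2) z.1 := by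
    have := wt_le_of_le (s := s / 2) (a := z.1) (b := z) (c := 1) (by linarith) (by norm_num)
      (by linarith [norm_fst_le z])
    simpa using this
  have h2 : wt (s / 2) z ≤ wt (s / 2) z.2 := by
    have := wt_le_of_le (s := s / 2) (a := z.2) (b := z) (c := 1) (by linarith) (by norm_num)
      (by linarith [norm_snd_le z])
    simpa using this
  rw [h]
  exact mul_le_mul h1 h2 (wt_nonneg _ _) (wt_nonneg _ _)

variable [NormedSpace ℝ E] [FiniteDimensional ℝ E] [MeasurableSpace E] [BorelSpace E]
  (μ : Measure E) [μ.IsAddHaarMeasure]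

lemma integrable_wt (hs : (Module.finrank ℝ E : ℝ) < s) : Integrable (wt s : E → ℝ) μ :=
  integrable_one_add_norm hs

lemma integrable_wt_sub (hs : (Module.finrank ℝ E : ℝ) < s) (z : E) :
    Integrable (fun a => wt s (a - z)) μ :=
  (integrable_wt μ hs).comp_sub_right z

lemma integrable_wt_mul_wt (hs : (Module.finrank ℝ E : ℝ) < s) (z w : E) :
    Integrable (fun a => wt s (a - z) * wt s (a - w)) μ := by
  have hs0 : 0 ≤ s := (Nat.cast_nonneg _).trans hs.le
  refine (((integrable_wt_sub μ hs z).add (integrable_wt_sub μ hs w)).const_mul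
    (2 ^ s * wt s (w - z))).mono' ?_ ?_
  · exact (((continuous_wt s).comp (continuous_id.sub continuous_const)).mul
      ((continuous_wt s).comp (continuous_id.sub continuous_const))).aestronglyMeasurable
  · refine .of_forall fun a => ?_
    rw [Real.norm_of_nonneg (mul_nonneg (wt_nonneg _ _) (wt_nonneg _ _))]
    exact wt_mul_wt_le hs0 z w a

lemma integral_wt_mul_wt_le (hs : (Module.finrank ℝ E : ℝ) < s) (z w : E) :
    ∫ a, wt s (a - z) * wt s (a - w) ∂μ ≤ 2 ^ s * (2 * ∫ a : E, wt s a ∂μ) * wt s (w - z) := by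
  have hs0 : 0 ≤ s := (Nat.cast_nonneg _).trans hs.le
  calc ∫ a, wt s (a - z) * wt s (a - w) ∂μ
      ≤ ∫ a, 2 ^ s * wt s (w - z) * (wt s (a - z) + wt s (a - w)) ∂μ :=
        integral_mono (integrable_wt_mul_wt μ hs z w)
          (((integrable_wt_sub μ hs z).add (integrable_wt_sub μ hs w)).const_mul _)
          (wt_mul_wt_le hs0 z w)
    _ = _ := by
        rw [integral_const_mul, integral_add (integrable_wt_sub μ hs z) (integrable_wt_sub μ hs w),
          integral_sub_right_eq_self (wt s) z, integral_sub_right_eq_self (wt s) w]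
        ring

end Weight

section Trotter

variable {H : Type*} [NormedAddCommGroup H] [NormedSpace ℂ H]

/-- The terms of the Dyson series of `x' = B(r) x`, `x(0) = φ`. -/
def dyson (B : ℝ → H →L[ℂ] H) (φ : H) : ℕ → ℝ → H
  | 0 => fun _ => φ
  | k + 1 => fun s => ∫ r in (0 : ℝ)..s, B r (dyson B φ k r)

lemma continuous_dyson {B : ℝ → H →L[ℂ] H}
    (hB : ∀ y : ℝ → H, Continuous y → Continuous fun r => B r (y r)) (φ : H) (k : ℕ) :
    Continuous (dyson B φ k) := by
  induction k with
  | zero => exact continuous_const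
  | succ k ih =>
    exact intervalIntegral.continuous_primitive (fun a b => (hB _ ih).intervalIntegrable a b) 0

lemma continuous_apply_of_isometric {U : ℝ → H →L[ℂ] H} (hUiso : ∀ r x, ‖U r x‖ = ‖x‖)
    (hUc : ∀ x, Continuous fun r => U r x) {y : ℝ → H} (hy : Continuous y) :
    Continuous fun r => U r (y r) := by
  rw [continuous_iff_continuousAt]
  intro r₀
  have h1 : Tendsto (fun r => U r (y r - y r₀)) (𝓝 r₀) (𝓝 0) := by
    rw [tendsto_zero_iff_norm_tendsto_zero]
    simp_rw [hUiso]
    rw [← tendsto_zero_iff_norm_tendsto_zero]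
    have := (hy.tendsto r₀).sub_const (y r₀)
    rwa [sub_self] at this
  have h2 := h1.add ((hUc (y r₀)).tendsto r₀)
  simpa [ContinuousAt] using h2

variable [CompleteSpace H]

lemma hasDerivAt_dyson {B : ℝ → H →L[ℂ] H}
    (hB : ∀ y : ℝ → H, Continuous y → Continuous fun r => B r (y r)) (φ : H) (k : ℕ) (s : ℝ) :
    HasDerivAt (dyson B φ (k + 1)) (B s (dyson B φ k s)) s := by
  have hc := hB _ (continuous_dyson hB φ k)
  exact intervalIntegral.integral_hasDerivAt_right (hc.intervalIntegrable _ _)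
    hc.stronglyMeasurable.stronglyMeasurableAtFilter hc.continuousAt

lemma norm_dyson_le {B : ℝ → H →L[ℂ] H}
    (hB : ∀ y : ℝ → H, Continuous y → Continuous fun r => B r (y r)) {K : ℝ} (hK0 : 0 ≤ K)
    (hK : ∀ r x, ‖B r x‖ ≤ K * ‖x‖) (φ : H) (k : ℕ) (s : ℝ) :
    ‖dyson B φ k s‖ ≤ (K * |s|) ^ k / k.factorial * ‖φ‖ := by
  induction k generalizing s with
  | zero => simp [dyson]
  | succ k ih =>
    have hc := hB _ (continuous_dyson hB φ k)
    calc ‖dyson B φ (k + 1) s‖ ≤ ∫ r in Set.uIoc 0 s, ‖B r (dyson B φ k r)‖ :=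
          intervalIntegral.norm_integral_le_integral_norm_uIoc
      _ ≤ ∫ r in Set.uIoc 0 s, K ^ (k + 1) / k.factorial * ‖φ‖ * |r - 0| ^ k := by
          refine setIntegral_mono_on ?_ ?_ measurableSet_uIoc fun r _ => ?_
          · exact (intervalIntegrable_iff.1 (hc.norm.intervalIntegrable 0 s))
          · refine intervalIntegrable_iff.1 (Continuous.intervalIntegrable ?_ 0 s)
            fun_prop
          · refine (hK _ _).trans ((mul_le_mul_of_nonneg_left (ih r) hK0).trans (le_of_eq ?_))
            rw [sub_zero, mul_pow]
            ring
      _ = _ := by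
          rw [integral_const_mul, integral_pow_abs_sub_uIoc, Nat.factorial_succ, sub_zero]
          push_cast
          field_simp
          ring

lemma exists_linear_ode_solution {B : ℝ → H →L[ℂ] H}
    (hB : ∀ y : ℝ → H, Continuous y → Continuous fun r => B r (y r)) {K : ℝ} (hK0 : 0 ≤ K)
    (hK : ∀ r x, ‖B r x‖ ≤ K * ‖x‖) (φ : H) :
    ∃ x : ℝ → H, x 0 = φ ∧ ∀ r, HasDerivAt x (B r (x r)) r := by
  have hsum : ∀ s, Summable fun k => dyson B φ k s := fun s =>
    Summable.of_norm_bounded ((Real.summable_pow_div_factorial (K * |s|)).mul_right ‖φ‖)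
      fun k => norm_dyson_le hB hK0 hK φ k s
  refine ⟨fun s => ∑' k, dyson B φ k s, ?_, fun r => ?_⟩
  · refine (tsum_eq_single 0 fun k hk => ?_).trans rfl
    obtain ⟨j, rfl⟩ := Nat.exists_eq_succ_of_ne_zero hk
    simp [dyson]
  · set R := |r| + 1
    let g' : ℕ → ℝ → H := fun k s => Nat.casesOn k 0 fun j => B s (dyson B φ j s)
    let u : ℕ → ℝ := fun k => Nat.casesOn k 0 fun j => K * ((K * R) ^ j / j.factorial * ‖φ‖)
    have hu : Summable u := by
      refine (summable_nat_add_iff 1).1 ?_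
      exact ((Real.summable_pow_div_factorial (K * R)).mul_right ‖φ‖).mul_left K
    have hr : r ∈ Metric.ball (0 : ℝ) R := by simp [R]
    have h := hasDerivAt_tsum_of_isPreconnected (g := fun k => dyson B φ k) (g' := g') hu
      Metric.isOpen_ball (convex_ball (0 : ℝ) R).isPreconnected
      (fun k s _ => by
        cases k with
        | zero => exact hasDerivAt_const s φ
        | succ j => exact hasDerivAt_dyson hB φ j s)
      (fun k s hs => by
        cases k with
        | zero => simp [g', u]
        | succ j =>
          have hs' : |s| ≤ R := by
            have := Metric.mem_ball.1 hs
            rw [Real.dist_eq, sub_zero] at this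
            exact this.le
          refine (hK _ _).trans (mul_le_mul_of_nonneg_left
            ((norm_dyson_le hB hK0 hK φ j s).trans ?_) hK0)
          gcongr)
      hr (hsum r) hr
    have hg' : ∑' k, g' k r = B r (∑' k, dyson B φ k r) := by
      rw [(B r).map_tsum (hsum r)]
      have hs : Summable fun k => g' k r := by
        refine (summable_nat_add_iff 1).1 ?_
        exact (B r).summable (hsum r)
      rw [hs.tsum_eq_zero_add]
      simp [g']
    rwa [hg'] at h

/-- **Trotter product formula** for an isometric strongly continuous group and a bounded
perturbation, along positive times. -/
lemma trotter_tendsto_of_pos {U : ℝ → H →L[ℂ] H} (hU0 : U 0 = 1)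
    (hUadd : ∀ a b, U (a + b) = (U a).comp (U b)) (hUiso : ∀ r x, ‖U r x‖ = ‖x‖)
    (hUc : ∀ x, Continuous fun r => U r x) (W : H →L[ℂ] H) {M : ℝ → H →L[ℂ] H}
    (hM1 : ∀ τ x, ‖M τ x‖ ≤ ‖x‖) {t C : ℝ} (hC : 0 ≤ C) (ht : 0 < t)
    (hM : ∀ τ, |τ| ≤ t → ∀ x, ‖x + τ • W x - M τ x‖ ≤ C * τ ^ 2 * ‖x‖) (φ : H) :
    ∃ ψ, Tendsto (fun n : ℕ => (((U (t / n)).comp (M (t / n))) ^ n) φ) atTop (𝓝 ψ) := by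
  let B : ℝ → H →L[ℂ] H := fun r => (U (-r)).comp (W.comp (U r))
  have hB : ∀ y : ℝ → H, Continuous y → Continuous fun r => B r (y r) := fun y hy =>
    (continuous_apply_of_isometric (U := fun r => U (-r)) (fun r x => hUiso _ x)
      (fun x => (hUc x).comp continuous_neg)
      (W.continuous.comp (continuous_apply_of_isometric hUiso hUc hy)))
  have hK : ∀ r x, ‖B r x‖ ≤ ‖W‖ * ‖x‖ := fun r x => by
    simp only [B, ContinuousLinearMap.comp_apply, hUiso]
    exact (W.le_opNorm _).trans_eq (by rw [hUiso])
  obtain ⟨x, hx0, hx⟩ := exists_linear_ode_solution hB (norm_nonneg W) hK φ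
  have hxc : Continuous x := continuous_iff_continuousAt.2 fun r => (hx r).continuousAt
  have hFc : Continuous fun r => B r (x r) := hB x hxc
  obtain ⟨X, hX⟩ := isCompact_Icc.exists_bound_of_continuousOn (s := Set.Icc 0 t) hxc.continuousOn
  have hUinv : ∀ r y, U r (U (-r) y) = y := fun r y => by
    rw [← ContinuousLinearMap.comp_apply, ← hUadd, add_neg_cancel, hU0]
    rfl
  refine ⟨U t (x t), ?_⟩
  rw [Metric.tendsto_atTop]
  intro ε hε
  have huc := (isCompact_Icc (a := (0 : ℝ)) (b := t)).uniformContinuousOn_of_continuous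
    hFc.continuousOn
  rw [Metric.uniformContinuousOn_iff_le] at huc
  obtain ⟨δ, hδ, hFδ⟩ := huc (ε / (4 * t)) (by positivity)
  have hX0 : 0 ≤ X := (norm_nonneg _).trans (hX 0 ⟨le_rfl, ht.le⟩)
  have hlim : Tendsto (fun n : ℕ => t / (n : ℝ)) atTop (𝓝 0) :=
    tendsto_const_div_atTop_nhds_zero_nat t
  have hev1 : ∀ᶠ n : ℕ in atTop, t / n < δ := hlim.eventually_lt_const hδ
  have hev2 : ∀ᶠ n : ℕ in atTop, t / n < ε / (4 * t * (C * X + 1)) :=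
    hlim.eventually_lt_const (by positivity)
  obtain ⟨N, hN⟩ := eventually_atTop.1 ((hev1.and hev2).and (eventually_ge_atTop 1))
  refine ⟨N, fun n hn => ?_⟩
  obtain ⟨⟨hn1, hn2⟩, hn3⟩ := hN n hn
  have hnpos : (0 : ℝ) < n := by exact_mod_cast hn3
  set τ := t / n with hτ
  have hτ0 : 0 < τ := div_pos ht hnpos
  have hnτ : n * τ = t := by rw [hτ]; field_simp
  have hτt : |τ| ≤ t := by
    rw [abs_of_pos hτ0, ← hnτ]
    exact le_mul_of_one_le_left hτ0.le (by exact_mod_cast hn3)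
  let p : ℕ → H := fun m => U (-(m * τ)) ((((U τ).comp (M τ)) ^ m) φ)
  have hp : ∀ m : ℕ, p (m + 1) = U (-(m * τ)) (M τ (U (m * τ) (p m))) := fun m => by
    simp only [p]
    rw [hUinv, pow_succ', mul_apply_eq_comp, ContinuousLinearMap.comp_apply,
      ← ContinuousLinearMap.comp_apply, ← hUadd]
    congr 2
    push_cast
    ring
  have key : ∀ m : ℕ, m ≤ n → ‖x (m * τ) - p m‖ ≤ m * (τ * (ε / (4 * t)) + C * τ ^ 2 * X) := by
    intro m
    induction m with
    | zero => intro _; simp [p, hU0, hx0]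
    | succ m ih =>
      intro hm
      have hm' : (m : ℝ) + 1 ≤ n := by exact_mod_cast hm
      have h0 : 0 ≤ (m : ℝ) * τ := by positivity
      have h1 : ((m : ℝ) + 1) * τ ≤ t := by
        rw [← hnτ]
        exact mul_le_mul_of_nonneg_right hm' hτ0.le
      have hmem : (m : ℝ) * τ ∈ Set.Icc 0 t := ⟨h0, by nlinarith⟩
      set b := B (m * τ) (x (m * τ)) with hb
      have hstep : ‖(x ((m + 1) * τ) - ((m + 1) * τ) • b) - (x (m * τ) - ((m : ℝ) * τ) • b)‖
          ≤ ε / (4 * t) * ‖((m : ℝ) + 1) * τ - m * τ‖ := by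
        refine (convex_Icc ((m : ℝ) * τ) ((m + 1) * τ)).norm_image_sub_le_of_norm_hasDerivWithin_le
          (f := fun r : ℝ => x r - r • b) (f' := fun r => B r (x r) - (1 : ℝ) • b)
          (fun r _ => ((hx r).sub ((hasDerivAt_id r).smul_const b)).hasDerivWithinAt)
          (fun r hr => ?_) ⟨le_rfl, by nlinarith⟩ ⟨by nlinarith, le_rfl⟩
        rw [one_smul, hb, ← dist_eq_norm]
        refine hFδ r ⟨h0.trans hr.1, hr.2.trans h1⟩ _ hmem ?_
        rw [Real.dist_eq, abs_of_nonneg (by linarith [hr.1])]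
        linarith [hr.2, hn1.le]
      have hstep2 : ‖x (m * τ) + τ • b - U (-(m * τ)) (M τ (U (m * τ) (x (m * τ))))‖
          ≤ C * τ ^ 2 * X := by
        have h2 := hM τ hτt (U (m * τ) (x (m * τ)))
        rw [hUiso] at h2
        rw [← hUiso (-((m : ℝ) * τ))] at h2
        have hUinv' : U (-(m * τ)) (U (m * τ) (x (m * τ))) = x (m * τ) := by
          have := hUinv (-(m * τ)) (x (m * τ))
          rwa [neg_neg] at this
        rw [map_sub, map_add, hUinv', ← Complex.coe_smul, map_smul, Complex.coe_smul] at h2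
        exact h2.trans (mul_le_mul_of_nonneg_left (hX _ hmem) (by positivity))
      have hstep3 : ‖U (-(m * τ)) (M τ (U (m * τ) (x (m * τ) - p m)))‖
          ≤ m * (τ * (ε / (4 * t)) + C * τ ^ 2 * X) := by
        rw [hUiso]
        exact (hM1 _ _).trans ((hUiso _ _).le.trans (ih (by omega)))
      have hdec : x ((m + 1 : ℕ) * τ) - p (m + 1) =
          ((x ((m + 1) * τ) - ((m + 1) * τ) • b) - (x (m * τ) - ((m : ℝ) * τ) • b)) +
          (x (m * τ) + τ • b - U (-(m * τ)) (M τ (U (m * τ) (x (m * τ))))) +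
          U (-(m * τ)) (M τ (U (m * τ) (x (m * τ) - p m))) := by
        rw [hp]
        simp only [map_sub]
        push_cast
        module
      rw [hdec]
      refine (norm_add₃_le).trans ((add_le_add_three hstep hstep2 hstep3).trans (le_of_eq ?_))
      have : ‖((m : ℝ) + 1) * τ - m * τ‖ = τ := by
        rw [← sub_mul, add_sub_cancel_left, one_mul, Real.norm_of_nonneg hτ0.le]
      rw [this]
      push_cast
      ring
  have hfin := key n le_rfl
  have hEn : (((U τ).comp (M τ)) ^ n) φ = U t (p n) := by
    simp only [p]
    rw [hnτ, hUinv]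
  rw [dist_comm, dist_eq_norm, hEn, ← map_sub, hUiso]
  rw [hnτ] at hfin
  refine hfin.trans_lt ?_
  have e1 : (n : ℝ) * (τ * (ε / (4 * t)) + C * τ ^ 2 * X) = ε / 4 + t * (C * X) * τ := by
    calc (n : ℝ) * (τ * (ε / (4 * t)) + C * τ ^ 2 * X)
        = (n * τ) * (ε / (4 * t)) + (n * τ) * (C * X) * τ := by ring
      _ = _ := by rw [hnτ]; field_simp
  have e2 : t * (C * X + 1) * τ < ε / 4 := by
    have := mul_lt_mul_of_pos_left hn2 (show 0 < t * (C * X + 1) by positivity)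
    refine this.trans_eq ?_
    field_simp
  have e3 : 0 < t * τ := mul_pos ht hτ0
  rw [e1]
  nlinarith

/-- **Trotter product formula** for an isometric strongly continuous group and a bounded
perturbation. -/
lemma trotter_tendsto {U : ℝ → H →L[ℂ] H} (hU0 : U 0 = 1)
    (hUadd : ∀ a b, U (a + b) = (U a).comp (U b)) (hUiso : ∀ r x, ‖U r x‖ = ‖x‖)
    (hUc : ∀ x, Continuous fun r => U r x) (W : H →L[ℂ] H) {M : ℝ → H →L[ℂ] H}
    (hM1 : ∀ τ x, ‖M τ x‖ ≤ ‖x‖) {t C : ℝ} (hC : 0 ≤ C) (ht : t ≠ 0)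
    (hM : ∀ τ, |τ| ≤ |t| → ∀ x, ‖x + τ • W x - M τ x‖ ≤ C * τ ^ 2 * ‖x‖) (φ : H) :
    ∃ ψ, Tendsto (fun n : ℕ => (((U (t / n)).comp (M (t / n))) ^ n) φ) atTop (𝓝 ψ) := by
  rcases ht.lt_or_gt with h | h
  · have := trotter_tendsto_of_pos (U := fun r => U (-r)) (by simpa using hU0)
      (fun a b => by rw [neg_add, hUadd]) (fun r x => hUiso _ x)
      (fun x => (hUc x).comp continuous_neg) (-W) (M := fun τ => M (-τ)) (fun τ x => hM1 _ x)
      hC (neg_pos.2 h) (fun τ hτ x => by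
        have := hM (-τ) (by rwa [abs_neg, abs_of_neg h]) x
        simpa using this) φ
    simpa [neg_div] using this
  · exact trotter_tendsto_of_pos hU0 hUadd hUiso hUc W hM1 hC h
      (by rwa [abs_of_pos h] at hM) φ

end Trotter

section Packet

variable {d : ℕ}

/-- The Gaussian wave packet of width parameter `a` centered at the phase-space point `z`. -/
def packet (a : ℝ) (z : Euc d × Euc d) (y : Euc d) : ℂ :=
  Complex.exp (((2 * π * ⟪z.2, y⟫ : ℝ) : ℂ) * Complex.I) *
    ((Real.exp (-π * a * ‖y - z.1‖ ^ 2) : ℝ) : ℂ)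

lemma continuous_packet_uncurry (a : ℝ) :
    Continuous fun p : (Euc d × Euc d) × Euc d => packet a p.1 p.2 := by
  unfold packet
  fun_prop

lemma continuous_packet (a : ℝ) (z : Euc d × Euc d) : Continuous (packet a z) := by
  unfold packet
  fun_prop

lemma continuous_packet_left (a : ℝ) (y : Euc d) :
    Continuous fun z : Euc d × Euc d => packet a z y := by
  unfold packet
  fun_prop

lemma norm_packet (a : ℝ) (z : Euc d × Euc d) (y : Euc d) :
    ‖packet a z y‖ = Real.exp (-π * a * ‖y - z.1‖ ^ 2) := by
  rw [packet, norm_mul, Complex.norm_exp_ofReal_mul_I, one_mul, Complex.norm_real,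
    Real.norm_of_nonneg (Real.exp_pos _).le]

lemma norm_packet_le_one {a : ℝ} (ha : 0 ≤ a) (z : Euc d × Euc d) (y : Euc d) :
    ‖packet a z y‖ ≤ 1 := by
  rw [norm_packet, Real.exp_le_one_iff]
  have := mul_nonneg (mul_nonneg pi_pos.le ha) (sq_nonneg ‖y - z.1‖)
  linarith

lemma integrable_gauss {a : ℝ} (ha : 0 < a) (x : Euc d) :
    Integrable fun y : Euc d => Real.exp (-π * a * ‖y - x‖ ^ 2) := by
  have h := (GaussianFourier.integrable_cexp_neg_mul_sq_norm_add (V := Euc d)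
    (b := ((π * a : ℝ) : ℂ)) (by simpa using mul_pos pi_pos ha) 0 0).norm.comp_sub_right x
  refine h.congr (.of_forall fun y => ?_)
  simp only [Complex.norm_exp]
  congr 1
  simp [← Complex.ofReal_pow]

lemma integral_gauss {a : ℝ} (ha : 0 < a) (x : Euc d) :
    ∫ y : Euc d, Real.exp (-π * a * ‖y - x‖ ^ 2) = (1 / a) ^ ((d : ℝ) / 2) := by
  rw [integral_sub_right_eq_self (fun y : Euc d => Real.exp (-π * a * ‖y‖ ^ 2)) x]
  have := GaussianFourier.integral_rexp_neg_mul_sq_norm (V := Euc d) (mul_pos pi_pos ha)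
  rw [finrank_euclideanSpace_fin] at this
  simp_rw [neg_mul] at this ⊢
  rw [this]
  congr 1
  field_simp

lemma integrable_packet {a : ℝ} (ha : 0 < a) (z : Euc d × Euc d) :
    Integrable (packet a z) := by
  refine (integrable_gauss ha z.1).mono' (continuous_packet a z).aestronglyMeasurable
    (.of_forall fun y => (norm_packet a z y).le)

lemma memLp_packet {a : ℝ} (ha : 0 < a) (z : Euc d × Euc d) : MemLp (packet a z) 2 := by
  rw [memLp_two_iff_integrable_sq_norm (continuous_packet a z).aestronglyMeasurable]
  refine (integrable_gauss (mul_pos two_pos ha) z.1).congr (.of_forall fun y => ?_)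
  simp only [norm_packet, ← Real.exp_nat_mul]
  congr 1
  push_cast
  ring

lemma chirp_mul_packet_mul_conj_packet (a b σ : ℝ) (z w : Euc d × Euc d) (y : Euc d) :
    Complex.exp (-(((σ * ‖y‖ ^ 2 : ℝ) : ℂ) * Complex.I)) * packet a z y *
      (starRingEnd ℂ) (packet b w y) =
    Complex.exp (((-π * (a * ‖y - z.1‖ ^ 2 + b * ‖y - w.1‖ ^ 2) : ℝ) : ℂ) +
      ((2 * π * ⟪z.2 - w.2, y⟫ - σ * ‖y‖ ^ 2 : ℝ) : ℂ) * Complex.I) := by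
  unfold packet
  rw [map_mul, Complex.conj_ofReal, ← Complex.exp_conj, Complex.ofReal_exp, Complex.ofReal_exp,
    ← Complex.exp_add, ← Complex.exp_add, ← Complex.exp_add, ← Complex.exp_add, map_mul,
    Complex.conj_I, Complex.conj_ofReal, inner_sub_left]
  congr 1
  push_cast
  ring

lemma norm_sq_combine {E : Type*} [NormedAddCommGroup E] [InnerProductSpace ℝ E] {a b : ℝ}
    (hab : a + b ≠ 0) (Y z w : E) :
    a * ‖Y + (z + (b / (a + b)) • (w - z)) - z‖ ^ 2 +
      b * ‖Y + (z + (b / (a + b)) • (w - z)) - w‖ ^ 2 =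
    (a + b) * ‖Y‖ ^ 2 + a * b / (a + b) * ‖w - z‖ ^ 2 := by
  have e1 : Y + (z + (b / (a + b)) • (w - z)) - z = Y + (b / (a + b)) • (w - z) := by module
  have e2 : Y + (z + (b / (a + b)) • (w - z)) - w = Y + (-(a / (a + b))) • (w - z) := by
    have : -(a / (a + b)) = b / (a + b) - 1 := by field_simp; ring
    rw [this]
    module
  rw [e1, e2, norm_add_sq_real, norm_add_sq_real, inner_smul_right, inner_smul_right, norm_smul,
    norm_smul, mul_pow, mul_pow, Real.norm_eq_abs, Real.norm_eq_abs, sq_abs, sq_abs]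
  field_simp
  ring

lemma norm_integral_chirp_packet {a b : ℝ} (ha : 0 < a) (hb : 0 < b) (σ : ℝ)
    (z w : Euc d × Euc d) :
    ‖∫ y, Complex.exp (-(((σ * ‖y‖ ^ 2 : ℝ) : ℂ) * Complex.I)) * packet a z y *
      (starRingEnd ℂ) (packet b w y)‖ ≤
    (1 / (a + b)) ^ ((d : ℝ) / 2) * (Real.exp (-(π * (a * b / (a + b))) * ‖w.1 - z.1‖ ^ 2) *
      Real.exp (-(π ^ 3 * (a + b) / ((π * (a + b)) ^ 2 + σ ^ 2)) *
        ‖w.2 - z.2 + (σ / π) • (z.1 + (b / (a + b)) • (w.1 - z.1))‖ ^ 2)) := by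
  have hab : 0 < a + b := add_pos ha hb
  set m := z.1 + (b / (a + b)) • (w.1 - z.1) with hm
  set v := w.2 - z.2 + (σ / π) • m with hv
  set β : ℂ := ((π * (a + b) : ℝ) : ℂ) + (σ : ℂ) * Complex.I with hβ
  have hβre : β.re = π * (a + b) := by simp [hβ]
  have hβim : β.im = σ := by simp [hβ]
  have hβpos : 0 < β.re := by rw [hβre]; positivity
  have hβ0 : β ≠ 0 := fun h => by simp [h] at hβpos
  simp_rw [chirp_mul_packet_mul_conj_packet]
  rw [← integral_add_right_eq_self _ m]
  have hpt : ∀ Y : Euc d, Complex.exp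
      (((-π * (a * ‖Y + m - z.1‖ ^ 2 + b * ‖Y + m - w.1‖ ^ 2) : ℝ) : ℂ) +
        ((2 * π * ⟪z.2 - w.2, Y + m⟫ - σ * ‖Y + m‖ ^ 2 : ℝ) : ℂ) * Complex.I) =
      Complex.exp (((-(π * (a * b / (a + b))) * ‖w.1 - z.1‖ ^ 2 : ℝ) : ℂ) +
        ((2 * π * ⟪z.2 - w.2, m⟫ - σ * ‖m‖ ^ 2 : ℝ) : ℂ) * Complex.I) *
      Complex.exp (-β * ‖Y‖ ^ 2 + (-(2 * π * Complex.I)) * ⟪v, Y⟫) := by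
    intro Y
    rw [← Complex.exp_add, hm, norm_sq_combine hab.ne' Y z.1 w.1, ← hm]
    have h2 : 2 * π * ⟪z.2 - w.2, Y + m⟫ - σ * ‖Y + m‖ ^ 2 =
        (2 * π * ⟪z.2 - w.2, m⟫ - σ * ‖m‖ ^ 2) - σ * ‖Y‖ ^ 2 - 2 * π * ⟪v, Y⟫ := by
      rw [hv, norm_add_sq_real, inner_add_right, inner_add_left, inner_smul_left, inner_sub_left,
        inner_sub_left, inner_sub_left, real_inner_comm Y m]
      simp only [conj_trivial]
      field_simp
      ring
    rw [h2, hβ]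
    congr 1
    push_cast
    ring
  simp_rw [hpt]
  rw [integral_const_mul, GaussianFourier.integral_cexp_neg_mul_sq_norm_add hβpos, norm_mul,
    norm_mul, Complex.norm_exp, finrank_euclideanSpace_fin]
  have e1 : ‖((π : ℂ) / β) ^ ((d : ℂ) / 2)‖ ≤ (1 / (a + b)) ^ ((d : ℝ) / 2) := by
    have : ((d : ℂ) / 2) = (((d : ℝ) / 2 : ℝ) : ℂ) := by push_cast; rfl
    rw [this, Complex.norm_cpow_real]
    refine Real.rpow_le_rpow (norm_nonneg _) ?_ (by positivity)
    rw [norm_div, Complex.norm_real, Real.norm_of_nonneg pi_pos.le]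
    have h1 := Complex.re_le_norm β
    rw [hβre] at h1
    rw [div_le_div_iff₀ (norm_pos_iff.2 hβ0) hab]
    linarith
  have e2 : ‖Complex.exp ((-(2 * π * Complex.I)) ^ 2 * (‖v‖ : ℂ) ^ 2 / (4 * β))‖ =
      Real.exp (-(π ^ 3 * (a + b) / ((π * (a + b)) ^ 2 + σ ^ 2)) * ‖v‖ ^ 2) := by
    rw [Complex.norm_exp]
    congr 1
    have h3 : (-(2 * π * Complex.I)) ^ 2 * (‖v‖ : ℂ) ^ 2 / (4 * β) =
        ((-(π ^ 2 * ‖v‖ ^ 2) : ℝ) : ℂ) * β⁻¹ := by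
      have : (-(2 * π * Complex.I)) ^ 2 = -4 * (π : ℂ) ^ 2 := by
        rw [neg_sq, mul_pow, Complex.I_sq]
        ring
      rw [this]
      push_cast
      field_simp
    rw [h3, Complex.re_ofReal_mul, Complex.inv_re, hβre, Complex.normSq_apply, hβre, hβim]
    ring
  have e3 : (((-(π * (a * b / (a + b))) * ‖w.1 - z.1‖ ^ 2 : ℝ) : ℂ) +
      ((2 * π * ⟪z.2 - w.2, m⟫ - σ * ‖m‖ ^ 2 : ℝ) : ℂ) * Complex.I).re =
      -(π * (a * b / (a + b))) * ‖w.1 - z.1‖ ^ 2 := by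
    rw [Complex.add_re, Complex.ofReal_re, Complex.re_ofReal_mul, Complex.I_re, mul_zero, add_zero]
  rw [e3, e2, mul_left_comm]
  exact mul_le_mul_of_nonneg_right e1 (by positivity)

lemma exp_mul_exp_le_wt {s κ κ' Λ : ℝ} (hs : 0 ≤ s) (hκ : 0 < κ) (hκ' : 0 < κ') (hΛ : 0 ≤ Λ) :
    ∃ C : ℝ, 0 ≤ C ∧ ∀ A B' B : Euc d, ‖B‖ ≤ ‖B'‖ + Λ * ‖A‖ →
      Real.exp (-κ * ‖A‖ ^ 2) * Real.exp (-κ' * ‖B'‖ ^ 2) ≤ C * wt s (A, B) := by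
  refine ⟨Real.exp ((2 * s) ^ 2 / (4 * κ)) * Real.exp (s ^ 2 / (4 * κ')) * (1 + Λ) ^ s,
    by positivity, fun A B' B hB => ?_⟩
  have h1 := exp_neg_mul_sq_le hκ (2 * s) (norm_nonneg A) (by positivity)
  have h2 := exp_neg_mul_sq_le hκ' s (norm_nonneg B') hs
  have hA := one_add_norm_pos A
  have hB' := one_add_norm_pos B'
  have h3 : (1 + ‖A‖) ^ (-(2 * s)) * (1 + ‖B'‖) ^ (-s) ≤ (1 + Λ) ^ s * wt s (A, B) := by
    have e : (1 + ‖A‖) ^ (-(2 * s)) * (1 + ‖B'‖) ^ (-s) =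
        (((1 + ‖A‖) ^ 2 * (1 + ‖B'‖)) ^ s)⁻¹ := by
      rw [← Real.rpow_neg (by positivity), Real.mul_rpow (by positivity) hB'.le,
        ← Real.rpow_natCast, ← Real.rpow_mul hA.le]
      congr 2
      push_cast
      ring
    have h4 : 1 + ‖(A, B)‖ ≤ (1 + Λ) * ((1 + ‖A‖) ^ 2 * (1 + ‖B'‖)) := by
      have hn : ‖(A, B)‖ ≤ ‖A‖ + (‖B'‖ + Λ * ‖A‖) := by
        rw [Prod.norm_mk]
        refine max_le ?_ ?_
        · have := mul_nonneg hΛ (norm_nonneg A)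
          linarith [norm_nonneg B']
        · linarith [norm_nonneg A]
      have a0 := norm_nonneg A
      have b0 := norm_nonneg B'
      have c1 := mul_nonneg a0 b0
      have c2 := mul_nonneg hΛ a0
      have c3 := mul_nonneg hΛ b0
      have c4 := mul_nonneg c2 b0
      have c5 := mul_nonneg (sq_nonneg ‖A‖) b0
      have c6 := mul_nonneg hΛ (sq_nonneg ‖A‖)
      have c7 := mul_nonneg hΛ c5
      nlinarith [sq_nonneg ‖A‖]
    have h5 : (1 + ‖(A, B)‖) ^ s ≤ (1 + Λ) ^ s * ((1 + ‖A‖) ^ 2 * (1 + ‖B'‖)) ^ s := by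
      rw [← Real.mul_rpow (by positivity) (by positivity)]
      exact Real.rpow_le_rpow (by positivity) h4 hs
    rw [e, wt, Real.rpow_neg (by positivity), ← div_eq_mul_inv, inv_le_comm₀ (by positivity)
      (by positivity), inv_div, div_le_iff₀ (by positivity)]
    linarith
  calc Real.exp (-κ * ‖A‖ ^ 2) * Real.exp (-κ' * ‖B'‖ ^ 2)
      ≤ (Real.exp ((2 * s) ^ 2 / (4 * κ)) * (1 + ‖A‖) ^ (-(2 * s))) *
        (Real.exp (s ^ 2 / (4 * κ')) * (1 + ‖B'‖) ^ (-s)) :=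
        mul_le_mul h1 h2 (Real.exp_pos _).le (by positivity)
    _ = Real.exp ((2 * s) ^ 2 / (4 * κ)) * Real.exp (s ^ 2 / (4 * κ')) *
        ((1 + ‖A‖) ^ (-(2 * s)) * (1 + ‖B'‖) ^ (-s)) := by ring
    _ ≤ Real.exp ((2 * s) ^ 2 / (4 * κ)) * Real.exp (s ^ 2 / (4 * κ')) *
        ((1 + Λ) ^ s * wt s (A, B)) := mul_le_mul_of_nonneg_left h3 (by positivity)
    _ = _ := by ring

lemma norm_integral_chirp_packet_le_wt {a b s Λ : ℝ} (ha : 0 < a) (hb : 0 < b) (hs : 0 ≤ s)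
    (hΛ : 0 ≤ Λ) :
    ∃ C : ℝ, 0 ≤ C ∧ ∀ σ : ℝ, |σ| ≤ Λ → ∀ z w : Euc d × Euc d,
      ‖∫ y, Complex.exp (-(((σ * ‖y‖ ^ 2 : ℝ) : ℂ) * Complex.I)) * packet a z y *
        (starRingEnd ℂ) (packet b w y)‖ ≤
      C * wt s (w.1 - z.1, w.2 - z.2 + (σ / π) • z.1) := by
  have hab : 0 < a + b := add_pos ha hb
  obtain ⟨C, hC, h⟩ := exp_mul_exp_le_wt (d := d) (s := s) (κ := π * (a * b / (a + b)))
    (κ' := π ^ 3 * (a + b) / ((π * (a + b)) ^ 2 + Λ ^ 2)) (Λ := Λ / π) hs (by positivity)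
    (by positivity) (by positivity)
  refine ⟨(1 / (a + b)) ^ ((d : ℝ) / 2) * C, by positivity, fun σ hσ z w => ?_⟩
  refine (norm_integral_chirp_packet ha hb σ z w).trans ?_
  rw [mul_assoc]
  refine mul_le_mul_of_nonneg_left ?_ (by positivity)
  set B' := w.2 - z.2 + (σ / π) • (z.1 + (b / (a + b)) • (w.1 - z.1)) with hB'
  refine le_trans ?_ (h (w.1 - z.1) B' (w.2 - z.2 + (σ / π) • z.1) ?_)
  · have hσ2 : σ ^ 2 ≤ Λ ^ 2 := sq_le_sq.2 (by rwa [abs_of_nonneg hΛ])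
    gcongr
  · have e : w.2 - z.2 + (σ / π) • z.1 = B' - (σ / π * (b / (a + b))) • (w.1 - z.1) := by
      rw [hB']
      module
    rw [e]
    refine (norm_sub_le _ _).trans (add_le_add_right ?_ _)
    rw [norm_smul]
    refine mul_le_mul_of_nonneg_right ?_ (norm_nonneg _)
    rw [norm_mul, norm_div, Real.norm_eq_abs, Real.norm_of_nonneg pi_pos.le,
      Real.norm_of_nonneg (by positivity)]
    have : b / (a + b) ≤ 1 := by
      rw [div_le_one hab]
      linarith
    calc |σ| / π * (b / (a + b)) ≤ Λ / π * 1 := by gcongr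
      _ = _ := mul_one _

end Packet

section CoherentStates

variable {d : ℕ}

instance isAddHaarMeasure_phaseSpace :
    (volume : Measure (Euc d × Euc d)).IsAddHaarMeasure :=
  inferInstanceAs (((volume : Measure (Euc d)).prod (volume : Measure (Euc d))).IsAddHaarMeasure)

lemma finrank_phaseSpace (d : ℕ) : Module.finrank ℝ (Euc d × Euc d) = 2 * d := by
  rw [Module.finrank_prod, finrank_euclideanSpace_fin, two_mul]

/-- The normalized coherent state centered at the phase-space point `z`. -/
def coh (z : Euc d × Euc d) : L2Sp d := (memLp_packet one_half_pos z).toLp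

lemma coh_ae (z : Euc d × Euc d) : (coh z : Euc d → ℂ) =ᵐ[volume] packet (1 / 2) z :=
  MemLp.coeFn_toLp _

lemma inner_coh (z : Euc d × Euc d) (f : L2Sp d) :
    inner ℂ (coh z) f = ∫ y, f y * (starRingEnd ℂ) (packet (1 / 2) z y) := by
  rw [L2.inner_def]
  refine integral_congr_ae ?_
  filter_upwards [coh_ae z] with y hy
  rw [hy, RCLike.inner_apply]

lemma inner_coh_coh (z w : Euc d × Euc d) :
    inner ℂ (coh w) (coh z) =
      ∫ y, packet (1 / 2) z y * (starRingEnd ℂ) (packet (1 / 2) w y) := by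
  rw [inner_coh]
  refine integral_congr_ae ?_
  filter_upwards [coh_ae z] with y hy
  rw [hy]

lemma packet_mul_conj_self (z : Euc d × Euc d) (y : Euc d) :
    packet (1 / 2) z y * (starRingEnd ℂ) (packet (1 / 2) z y) =
      ((Real.exp (-π * 1 * ‖y - z.1‖ ^ 2) : ℝ) : ℂ) := by
  rw [Complex.mul_conj, Complex.normSq_eq_norm_sq, norm_packet, ← Real.exp_nat_mul]
  congr 2
  push_cast
  ring

lemma inner_coh_self (z : Euc d × Euc d) : inner ℂ (coh z) (coh z) = 1 := by
  rw [inner_coh_coh]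
  simp_rw [packet_mul_conj_self]
  rw [integral_complex_ofReal, integral_gauss one_pos]
  simp

lemma norm_coh (z : Euc d × Euc d) : ‖coh z‖ = 1 := by
  have h := inner_self_eq_norm_sq_to_K (𝕜 := ℂ) (coh z)
  rw [inner_coh_self] at h
  have h2 : ‖coh z‖ ^ 2 = 1 := Complex.ofReal_injective (by simpa using h.symm)
  nlinarith [norm_nonneg (coh z)]

lemma continuous_inner_coh_coh (z : Euc d × Euc d) :
    Continuous fun w : Euc d × Euc d => inner ℂ (coh w) (coh z) := by
  simp_rw [inner_coh_coh]
  refine continuous_of_dominated (bound := fun y => ‖packet (1 / 2) z y‖) (fun w => ?_)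
    (fun w => .of_forall fun y => ?_) (integrable_packet one_half_pos z).norm
    (.of_forall fun y => ?_)
  · exact ((continuous_packet _ z).mul
      (Complex.continuous_conj.comp (continuous_packet _ w))).aestronglyMeasurable
  · rw [norm_mul, RCLike.norm_conj]
    exact mul_le_of_le_one_right (norm_nonneg _) (norm_packet_le_one one_half_pos.le w y)
  · exact continuous_const.mul (Complex.continuous_conj.comp (continuous_packet_left _ y))

lemma continuous_coh : Continuous (coh : Euc d × Euc d → L2Sp d) := by
  rw [continuous_iff_continuousAt]
  intro z
  rw [ContinuousAt, tendsto_iff_norm_sub_tendsto_zero]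
  have h1 : ∀ w, ‖coh w - coh z‖ = √(2 - 2 * (inner ℂ (coh w) (coh z)).re) := by
    intro w
    rw [eq_comm, Real.sqrt_eq_iff_eq_sq _ (norm_nonneg _), norm_sub_sq (𝕜 := ℂ), norm_coh, norm_coh]
    · simp only [RCLike.re_to_complex]
      ring
    · have := (Complex.re_le_norm _).trans (norm_inner_le_norm (𝕜 := ℂ) (coh w) (coh z))
      rw [norm_coh, norm_coh] at this
      linarith
  simp_rw [h1]
  have h2 : Continuous fun w => √(2 - 2 * (inner ℂ (coh w) (coh z)).re) := by
    have := continuous_inner_coh_coh z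
    fun_prop
  have h3 := h2.tendsto z
  rw [inner_coh_self] at h3
  simpa using h3

lemma continuous_inner_coh (f : L2Sp d) :
    Continuous fun w : Euc d × Euc d => inner ℂ (coh w) f :=
  continuous_coh.inner continuous_const

lemma memLp_mul_packet (f : L2Sp d) {a : ℝ} (ha : 0 ≤ a) (z : Euc d × Euc d) :
    MemLp (fun y => f y * (starRingEnd ℂ) (packet a z y)) 2 :=
  MemLp.mul (p := 2) (q := ⊤) (memLp_top_of_bound
    (Complex.continuous_conj.comp (continuous_packet a z)).aestronglyMeasurable 1
    (.of_forall fun y => by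
      simpa using norm_packet_le_one ha z y)) (Lp.memLp f)

lemma integrable_mul_packet (f : L2Sp d) {a : ℝ} (ha : 0 < a) (z : Euc d × Euc d) :
    Integrable (fun y => f y * (starRingEnd ℂ) (packet a z y)) :=
  (Lp.memLp f).integrable_mul (memLp_packet ha z).star

/-- Localization of `f ∈ L²` by a Gaussian centered at `x`. -/
def localize (x : Euc d) (f : L2Sp d) : L2Sp d :=
  (memLp_mul_packet f one_half_pos.le (x, 0)).toLp

lemma localize_ae (x : Euc d) (f : L2Sp d) : (localize x f : Euc d → ℂ) =ᵐ[volume]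
    fun y => f y * (starRingEnd ℂ) (packet (1 / 2) (x, 0) y) :=
  MemLp.coeFn_toLp _

lemma inner_localize_localize (x : Euc d) (h f : L2Sp d) :
    inner ℂ (localize x h) (localize x f) =
      ∫ y, f y * (starRingEnd ℂ) (h y) * ((Real.exp (-π * 1 * ‖y - x‖ ^ 2) : ℝ) : ℂ) := by
  rw [L2.inner_def]
  refine integral_congr_ae ?_
  filter_upwards [localize_ae x h, localize_ae x f] with y h1 h2
  rw [h1, h2, RCLike.inner_apply, ← packet_mul_conj_self (x, 0) y, map_mul, Complex.conj_conj]
  ring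

lemma integrable_prod_gauss {k : Euc d → ℂ} (hk : Integrable k) :
    Integrable (fun p : Euc d × Euc d => k p.2 * ((Real.exp (-π * 1 * ‖p.2 - p.1‖ ^ 2) : ℝ) : ℂ))
      (volume.prod volume) := by
  refine (Integrable.convolution_integrand (ContinuousLinearMap.mul ℝ ℂ) hk
    ((integrable_gauss one_pos (0 : Euc d)).ofReal (𝕜 := ℂ))).congr (.of_forall fun p => ?_)
  simp [norm_sub_rev p.1 p.2]

section Fourier

variable (F : L2Sp d ≃ₗᵢ[ℂ] L2Sp d)
    (hF : ∀ f : L2Sp d, Integrable (f : Euc d → ℂ) →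
      (F f : Euc d → ℂ) =ᵐ[volume] fun ξ =>
        ∫ x, Complex.exp (-(((2 * π * ⟪ξ, x⟫ : ℝ) : ℂ) * Complex.I)) * f x)

include hF in
lemma fourier_localize_ae (x : Euc d) (f : L2Sp d) :
    (F (localize x f) : Euc d → ℂ) =ᵐ[volume] fun ξ => inner ℂ (coh (x, ξ)) f := by
  refine (hF _ ((integrable_mul_packet f one_half_pos (x, 0)).congr (localize_ae x f).symm)).trans
    (.of_forall fun ξ => ?_)
  simp only
  rw [inner_coh]
  refine integral_congr_ae ?_
  filter_upwards [localize_ae x f] with y hy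
  rw [hy]
  simp only [packet, map_mul, ← Complex.exp_conj, Complex.conj_I, Complex.conj_ofReal,
    inner_zero_left, mul_zero, Complex.ofReal_zero, zero_mul, Complex.exp_zero, one_mul, mul_neg]
  ring

include hF in
lemma integral_inner_coh_fiber (x : Euc d) (h f : L2Sp d) :
    Integrable (fun ξ => inner ℂ h (coh (x, ξ)) * inner ℂ (coh (x, ξ)) f) ∧
    ∫ ξ, inner ℂ h (coh (x, ξ)) * inner ℂ (coh (x, ξ)) f =
      ∫ y, f y * (starRingEnd ℂ) (h y) * ((Real.exp (-π * 1 * ‖y - x‖ ^ 2) : ℝ) : ℂ) := by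
  have e : (fun ξ => inner ℂ ((F (localize x h) : Euc d → ℂ) ξ) ((F (localize x f) : Euc d → ℂ) ξ))
      =ᵐ[volume] fun ξ => inner ℂ h (coh (x, ξ)) * inner ℂ (coh (x, ξ)) f := by
    filter_upwards [fourier_localize_ae F hF x h, fourier_localize_ae F hF x f] with ξ h1 h2
    rw [h1, h2, RCLike.inner_apply, inner_conj_symm, mul_comm]
  refine ⟨(L2.integrable_inner _ _).congr e, ?_⟩
  rw [← integral_congr_ae e, ← inner_localize_localize, ← L2.inner_def, F.inner_map_map]

include hF in
lemma integrable_norm_inner_coh_sq (f : L2Sp d) :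
    Integrable (fun a : Euc d × Euc d => ‖inner ℂ (coh a) f‖ ^ 2) := by
  have hm : Continuous (fun a : Euc d × Euc d => ‖inner ℂ (coh a) f‖ ^ 2) :=
    (continuous_inner_coh f).norm.pow 2
  have e : ∀ a : Euc d × Euc d, ‖inner ℂ (coh a) f‖ ^ 2 =
      (inner ℂ f (coh a) * inner ℂ (coh a) f).re := by
    intro a
    rw [← inner_conj_symm f, mul_comm, Complex.mul_conj, Complex.ofReal_re,
      Complex.normSq_eq_norm_sq]
  rw [Measure.volume_eq_prod, integrable_prod_iff hm.aestronglyMeasurable]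
  refine ⟨.of_forall fun x => ?_, ?_⟩
  · simp_rw [e]
    exact (integral_inner_coh_fiber F hF x f f).1.re
  · have e2 : ∀ x : Euc d, ∫ ξ, ‖‖inner ℂ (coh (x, ξ)) f‖ ^ 2‖ =
        (∫ y, f y * (starRingEnd ℂ) (f y) *
          ((Real.exp (-π * 1 * ‖y - x‖ ^ 2) : ℝ) : ℂ)).re := by
      intro x
      rw [← (integral_inner_coh_fiber F hF x f f).2, ← RCLike.re_eq_complex_re,
        ← integral_re (integral_inner_coh_fiber F hF x f f).1]
      simp_rw [Real.norm_of_nonneg (sq_nonneg _), e]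
      rfl
    simp_rw [e2]
    exact (integrable_prod_gauss ((Lp.memLp f).integrable_mul (Lp.memLp f).star)).integral_prod_left.re

include hF in
lemma integrable_inner_coh_mul (h f : L2Sp d) :
    Integrable (fun a : Euc d × Euc d => inner ℂ h (coh a) * inner ℂ (coh a) f) := by
  refine ((integrable_norm_inner_coh_sq F hF h).add (integrable_norm_inner_coh_sq F hF f)).mono'
    ((continuous_const.inner continuous_coh).mul
      (continuous_inner_coh f)).aestronglyMeasurable (.of_forall fun a => ?_)
  rw [norm_mul, norm_inner_symm h]
  simp only [Pi.add_apply]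
  nlinarith [sq_nonneg (‖inner ℂ (coh a) h‖ - ‖inner ℂ (coh a) f‖),
    sq_nonneg ‖inner ℂ (coh a) h‖, sq_nonneg ‖inner ℂ (coh a) f‖]

include hF in
/-- Resolution of the identity by coherent states. -/
lemma integral_inner_coh_mul (h f : L2Sp d) :
    ∫ a : Euc d × Euc d, inner ℂ h (coh a) * inner ℂ (coh a) f = inner ℂ h f := by
  have hi := integrable_inner_coh_mul F hF h f
  rw [Measure.volume_eq_prod] at hi ⊢
  have hk : Integrable (fun y => f y * (starRingEnd ℂ) (h y)) :=
    (Lp.memLp f).integrable_mul (Lp.memLp h).star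
  rw [integral_prod _ hi]
  simp_rw [(integral_inner_coh_fiber F hF _ h f).2]
  rw [integral_integral_swap (f := fun x y => f y * (starRingEnd ℂ) (h y) *
    ((Real.exp (-π * 1 * ‖y - x‖ ^ 2) : ℝ) : ℂ)) (integrable_prod_gauss hk), L2.inner_def]
  refine integral_congr_ae (.of_forall fun y => ?_)
  simp only
  rw [integral_const_mul, integral_complex_ofReal]
  simp_rw [norm_sub_rev y, integral_gauss one_pos]
  simp [RCLike.inner_apply]

/-- The constant in the weighted Schur estimates. -/
def schurConst (d : ℕ) (s : ℝ) : ℝ := 1 + 2 ^ s * (2 * ∫ a : Euc d × Euc d, wt s a)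

lemma schurConst_pos (d : ℕ) (s : ℝ) : 0 < schurConst d s :=
  add_pos_of_pos_of_nonneg one_pos
    (mul_nonneg (by positivity) (mul_nonneg two_pos.le (integral_nonneg fun a => wt_nonneg s a)))

include hF in
lemma norm_inner_le_of_wt {s : ℝ} (hs : 2 * d < s) {h f : L2Sp d} {z₀ w₀ : Euc d × Euc d}
    {C₁ C₂ : ℝ} (hC₁ : 0 ≤ C₁) (h1 : ∀ a, ‖inner ℂ (coh a) f‖ ≤ C₁ * wt s (a - z₀))
    (h2 : ∀ a, ‖inner ℂ (coh a) h‖ ≤ C₂ * wt s (a - w₀)) (hC₂ : 0 ≤ C₂) :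
    ‖inner ℂ h f‖ ≤ C₁ * C₂ * schurConst d s * wt s (w₀ - z₀) := by
  have hs' : (Module.finrank ℝ (Euc d × Euc d) : ℝ) < s := by
    rw [finrank_phaseSpace]
    exact_mod_cast hs
  rw [← integral_inner_coh_mul F hF]
  calc ‖∫ a : Euc d × Euc d, inner ℂ h (coh a) * inner ℂ (coh a) f‖
      ≤ ∫ a : Euc d × Euc d, C₁ * C₂ * (wt s (a - z₀) * wt s (a - w₀)) := by
        refine norm_integral_le_of_norm_le ((integrable_wt_mul_wt _ hs' z₀ w₀).const_mul _)
          (.of_forall fun a => ?_)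
        rw [norm_mul, norm_inner_symm]
        calc _ ≤ (C₂ * wt s (a - w₀)) * (C₁ * wt s (a - z₀)) :=
              mul_le_mul (h2 a) (h1 a) (norm_nonneg _) (mul_nonneg hC₂ (wt_nonneg _ _))
          _ = _ := by ring
    _ ≤ C₁ * C₂ * (schurConst d s * wt s (w₀ - z₀)) := by
        rw [integral_const_mul]
        refine mul_le_mul_of_nonneg_left ((integral_wt_mul_wt_le _ hs' z₀ w₀).trans ?_)
          (mul_nonneg hC₁ hC₂)
        exact mul_le_mul_of_nonneg_right (le_add_of_nonneg_left zero_le_one) (wt_nonneg _ _)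
    _ = _ := by ring

end Fourier

end CoherentStates

section FreeEvolution

variable {d : ℕ}

lemma norm_exp_neg_ofReal_mul_I (a : ℝ) : ‖Complex.exp (-((a : ℂ) * Complex.I))‖ = 1 := by
  rw [← neg_mul, ← Complex.ofReal_neg, Complex.norm_exp_ofReal_mul_I]

/-- The classical free flow on phase space (momenta in units of `2π`). -/
def freeFlow (r : ℝ) (z : Euc d × Euc d) : Euc d × Euc d := (z.1 + (2 * π * r) • z.2, z.2)

lemma fourier_packet (z : Euc d × Euc d) (ξ : Euc d) :
    ∫ y, Complex.exp (-(((2 * π * ⟪ξ, y⟫ : ℝ) : ℂ) * Complex.I)) * packet (1 / 2) z y =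
      2 ^ ((d : ℂ) / 2) * Complex.exp (((2 * π * ⟪z.2, z.1⟫ : ℝ) : ℂ) * Complex.I) *
        packet 2 (z.2, -z.1) ξ := by
  have hb : 0 < ((π / 2 : ℝ) : ℂ).re := by
    rw [Complex.ofReal_re]
    positivity
  rw [← integral_add_right_eq_self _ z.1]
  have hpt : ∀ y : Euc d, Complex.exp (-(((2 * π * ⟪ξ, y + z.1⟫ : ℝ) : ℂ) * Complex.I)) *
      packet (1 / 2) z (y + z.1) =
      Complex.exp (((2 * π * ⟪z.2 - ξ, z.1⟫ : ℝ) : ℂ) * Complex.I) *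
      Complex.exp (-((π / 2 : ℝ) : ℂ) * ‖y‖ ^ 2 + (-(2 * π * Complex.I)) * ⟪ξ - z.2, y⟫) := by
    intro y
    rw [packet, add_sub_cancel_right, Complex.ofReal_exp, ← Complex.exp_add, ← Complex.exp_add,
      ← Complex.exp_add, inner_add_right, inner_add_right, inner_sub_left, inner_sub_left]
    congr 1
    push_cast
    ring
  simp_rw [hpt]
  rw [integral_const_mul, GaussianFourier.integral_cexp_neg_mul_sq_norm_add hb,
    finrank_euclideanSpace_fin, packet]
  have e1 : (π : ℂ) / ((π / 2 : ℝ) : ℂ) = 2 := by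
    have : (π : ℂ) ≠ 0 := by exact_mod_cast pi_ne_zero
    push_cast
    field_simp
  have e2 : (-(2 * π * Complex.I)) ^ 2 * (‖ξ - z.2‖ : ℂ) ^ 2 / (4 * ((π / 2 : ℝ) : ℂ)) =
      ((-π * 2 * ‖ξ - z.2‖ ^ 2 : ℝ) : ℂ) := by
    have : (-(2 * π * Complex.I)) ^ 2 = -4 * (π : ℂ) ^ 2 := by
      rw [neg_sq, mul_pow, Complex.I_sq]
      ring
    rw [this]
    have : (π : ℂ) ≠ 0 := by exact_mod_cast pi_ne_zero
    push_cast
    field_simp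
  rw [e1, e2, Complex.ofReal_exp, mul_left_comm, ← Complex.exp_add, ← Complex.exp_add,
    mul_assoc ((2 : ℂ) ^ _), ← Complex.exp_add]
  congr 2
  rw [inner_sub_left, inner_neg_left, real_inner_comm ξ z.1]
  push_cast
  ring

lemma wt_swap_neg (s : ℝ) (A B : Euc d) : wt s (A, -B) = wt s (B, A) := by
  simp [wt, Prod.norm_def, max_comm]

variable (F : L2Sp d ≃ₗᵢ[ℂ] L2Sp d)
    (hF : ∀ f : L2Sp d, Integrable (f : Euc d → ℂ) →
      (F f : Euc d → ℂ) =ᵐ[volume] fun ξ =>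
        ∫ x, Complex.exp (-(((2 * π * ⟪ξ, x⟫ : ℝ) : ℂ) * Complex.I)) * f x)

include hF in
lemma fourier_coh_ae (z : Euc d × Euc d) : (F (coh z) : Euc d → ℂ) =ᵐ[volume] fun ξ =>
    2 ^ ((d : ℂ) / 2) * Complex.exp (((2 * π * ⟪z.2, z.1⟫ : ℝ) : ℂ) * Complex.I) *
        packet 2 (z.2, -z.1) ξ := by
  refine (hF _ ((integrable_packet one_half_pos z).congr (coh_ae z).symm)).trans
    (.of_forall fun ξ => ?_)
  simp only
  rw [← fourier_packet]
  refine integral_congr_ae ?_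
  filter_upwards [coh_ae z] with y hy
  rw [hy]

variable (U₀ : ℝ → L2Sp d →L[ℂ] L2Sp d)
    (hU₀ : ∀ (τ : ℝ) (f : L2Sp d),
      (F (U₀ τ f) : Euc d → ℂ) =ᵐ[volume] fun ξ =>
        Complex.exp (-(((2 * π ^ 2 * τ * ‖ξ‖ ^ 2 : ℝ) : ℂ) * Complex.I)) *
          (F f : Euc d → ℂ) ξ)

include hU₀ in
lemma free_zero : U₀ 0 = 1 := by
  ext1 f
  refine F.injective (Lp.ext ((hU₀ 0 f).trans (.of_forall fun ξ => ?_)))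
  simp

include hU₀ in
lemma free_add (a b : ℝ) : U₀ (a + b) = (U₀ a).comp (U₀ b) := by
  ext1 f
  refine F.injective (Lp.ext ?_)
  filter_upwards [hU₀ (a + b) f, hU₀ a (U₀ b f), hU₀ b f] with ξ h1 h2 h3
  rw [h1, ContinuousLinearMap.comp_apply, h2, h3, ← mul_assoc, ← Complex.exp_add]
  congr 2
  push_cast
  ring

include hU₀ in
lemma inner_free_free (a b : ℝ) (f h : L2Sp d) :
    inner ℂ (U₀ a f) (U₀ b h) =
      ∫ ξ, Complex.exp (-(((2 * π ^ 2 * (b - a) * ‖ξ‖ ^ 2 : ℝ) : ℂ) * Complex.I)) *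
        inner ℂ ((F f : Euc d → ℂ) ξ) ((F h : Euc d → ℂ) ξ) := by
  rw [← F.inner_map_map, L2.inner_def]
  refine integral_congr_ae ?_
  filter_upwards [hU₀ a f, hU₀ b h] with ξ h1 h2
  rw [h1, h2, RCLike.inner_apply, RCLike.inner_apply, map_mul, ← Complex.exp_conj, map_neg,
    map_mul, Complex.conj_I, Complex.conj_ofReal]
  have : Complex.exp (-(((2 * π ^ 2 * (b - a) * ‖ξ‖ ^ 2 : ℝ) : ℂ) * Complex.I)) =
      Complex.exp (-(((2 * π ^ 2 * b * ‖ξ‖ ^ 2 : ℝ) : ℂ) * Complex.I)) *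
        Complex.exp (-(((2 * π ^ 2 * a * ‖ξ‖ ^ 2 : ℝ) : ℂ) * -Complex.I)) := by
    rw [← Complex.exp_add]
    congr 1
    push_cast
    ring
  rw [this]
  ring

include hU₀ in
lemma inner_free_free_self (a : ℝ) (f h : L2Sp d) : inner ℂ (U₀ a f) (U₀ a h) = inner ℂ f h := by
  rw [inner_free_free F U₀ hU₀, ← F.inner_map_map f h, L2.inner_def]
  simp

include hU₀ in
lemma norm_free (a : ℝ) (f : L2Sp d) : ‖U₀ a f‖ = ‖f‖ := by
  rw [@norm_eq_sqrt_re_inner ℂ, @norm_eq_sqrt_re_inner ℂ _ _ _ _ f,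
    inner_free_free_self F U₀ hU₀]

include hU₀ in
lemma free_neg_apply (a : ℝ) (f : L2Sp d) : U₀ a (U₀ (-a) f) = f := by
  rw [← ContinuousLinearMap.comp_apply, ← free_add F U₀ hU₀, add_neg_cancel,
    free_zero F U₀ hU₀]
  rfl

include hU₀ in
lemma inner_free_left (a : ℝ) (f h : L2Sp d) : inner ℂ (U₀ a f) h = inner ℂ f (U₀ (-a) h) := by
  rw [← inner_free_free_self F U₀ hU₀ a f, free_neg_apply F U₀ hU₀]

include hU₀ in
lemma continuous_free (f : L2Sp d) : Continuous fun r => U₀ r f := by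
  rw [continuous_iff_continuousAt]
  intro r
  rw [ContinuousAt, tendsto_iff_norm_sub_tendsto_zero]
  have h1 : ∀ a, ‖U₀ a f - U₀ r f‖ = √(2 * ‖f‖ ^ 2 - 2 * (inner ℂ (U₀ r f) (U₀ a f)).re) := by
    intro a
    rw [eq_comm, Real.sqrt_eq_iff_eq_sq _ (norm_nonneg _), norm_sub_sq (𝕜 := ℂ),
      inner_re_symm (𝕜 := ℂ), norm_free F U₀ hU₀, norm_free F U₀ hU₀]
    · simp only [RCLike.re_to_complex]
      ring
    · have := (Complex.re_le_norm _).trans (norm_inner_le_norm (𝕜 := ℂ) (U₀ r f) (U₀ a f))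
      rw [norm_free F U₀ hU₀, norm_free F U₀ hU₀] at this
      linarith
  have h2 : Continuous fun a => inner ℂ (U₀ r f) (U₀ a f) := by
    simp_rw [inner_free_free F U₀ hU₀]
    have hi := L2.integrable_inner (𝕜 := ℂ) (F f) (F f)
    refine continuous_of_dominated (fun a => ?_) (fun a => .of_forall fun ξ => ?_) hi.norm
      (.of_forall fun ξ => ?_)
    · refine AEStronglyMeasurable.mul ?_ hi.aestronglyMeasurable
      exact Continuous.aestronglyMeasurable (by fun_prop)
    · rw [norm_mul, norm_exp_neg_ofReal_mul_I, one_mul]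
    · fun_prop
  have h3 : Continuous fun a => √(2 * ‖f‖ ^ 2 - 2 * (inner ℂ (U₀ r f) (U₀ a f)).re) := by
    fun_prop
  have h4 := h3.tendsto r
  rw [inner_free_free_self F U₀ hU₀, inner_self_eq_norm_sq_to_K] at h4
  simp_rw [h1]
  have h5 : (2 * ‖f‖ ^ 2 - 2 * (((‖f‖ : ℝ) : ℂ) ^ 2).re) = 0 := by
    rw [← Complex.ofReal_pow, Complex.ofReal_re, sub_self]
  simpa [h5] using h4

include hF hU₀ in
lemma norm_inner_coh_free_coh_le {s : ℝ} (hs : 0 ≤ s) {R : ℝ} (hR : 0 ≤ R) :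
    ∃ C : ℝ, 0 ≤ C ∧ ∀ r : ℝ, |r| ≤ R → ∀ z w : Euc d × Euc d,
      ‖inner ℂ (coh w) (U₀ r (coh z))‖ ≤ C * wt s (w - freeFlow r z) := by
  obtain ⟨C, hC, h⟩ := norm_integral_chirp_packet_le_wt (d := d) two_pos two_pos hs
    (Λ := 2 * π ^ 2 * R) (by positivity)
  refine ⟨‖(2 : ℂ) ^ ((d : ℂ) / 2)‖ * ‖(2 : ℂ) ^ ((d : ℂ) / 2)‖ * C, by positivity,
    fun r hr z w => ?_⟩
  have h1 := h (2 * π ^ 2 * r) (by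
    rw [abs_mul, abs_of_nonneg (by positivity : 0 ≤ 2 * π ^ 2)]
    gcongr) (z.2, -z.1) (w.2, -w.1)
  have e1 : wt s ((w.2, -w.1).1 - (z.2, -z.1).1, (w.2, -w.1).2 - (z.2, -z.1).2 +
      (2 * π ^ 2 * r / π) • (z.2, -z.1).1) = wt s (w - freeFlow r z) := by
    rw [freeFlow, ← wt_neg s (w - _)]
    have : (-(w - (z.1 + (2 * π * r) • z.2, z.2))) =
        (-w.1 + z.1 + (2 * π * r) • z.2, -(w.2 - z.2)) := by
      ext1
      · simp
        abel
      · simp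
    rw [this, wt_swap_neg]
    congr 2
    have : 2 * π ^ 2 * r / π = 2 * π * r := by
      field_simp
    simp [this]
  rw [e1] at h1
  have e2 : inner ℂ (coh w) (U₀ r (coh z)) = (2 : ℂ) ^ ((d : ℂ) / 2) *
      Complex.exp (((2 * π * ⟪z.2, z.1⟫ : ℝ) : ℂ) * Complex.I) *
      (starRingEnd ℂ) ((2 : ℂ) ^ ((d : ℂ) / 2) *
      Complex.exp (((2 * π * ⟪w.2, w.1⟫ : ℝ) : ℂ) * Complex.I)) *
      ∫ y, Complex.exp (-(((2 * π ^ 2 * r * ‖y‖ ^ 2 : ℝ) : ℂ) * Complex.I)) *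
        packet 2 (z.2, -z.1) y * (starRingEnd ℂ) (packet 2 (w.2, -w.1) y) := by
    rw [← F.inner_map_map, L2.inner_def, ← integral_const_mul]
    refine integral_congr_ae ?_
    filter_upwards [hU₀ r (coh z), fourier_coh_ae F hF z, fourier_coh_ae F hF w] with ξ h1 h2 h3
    rw [h1, h2, h3, RCLike.inner_apply, map_mul]
    ring
  rw [e2, norm_mul, norm_mul, norm_mul, RCLike.norm_conj, norm_mul, Complex.norm_exp_ofReal_mul_I,
    Complex.norm_exp_ofReal_mul_I, mul_one, mul_assoc _ C]
  exact mul_le_mul_of_nonneg_left h1 (by positivity)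

end FreeEvolution

section Potential

variable {d : ℕ}

lemma exists_potentialOp {V : Euc d → ℝ} (hVcont : Continuous V) {M : ℝ} (hM : ∀ x, |V x| ≤ M) :
    ∃ A : L2Sp d →L[ℂ] L2Sp d, ∀ f : L2Sp d,
      (A f : Euc d → ℂ) =ᵐ[volume] fun x => (V x : ℂ) * f x := by
  have hV : MemLp (fun x => (V x : ℂ)) ⊤ (volume : Measure (Euc d)) :=
    memLp_top_of_bound (Complex.continuous_ofReal.comp hVcont).aestronglyMeasurable M
      (.of_forall fun x => by simpa using hM x)
  refine ⟨(ContinuousLinearMap.mul ℂ ℂ).holderL volume ⊤ 2 2 hV.toLp, fun f => ?_⟩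
  filter_upwards [(ContinuousLinearMap.mul ℂ ℂ).coeFn_holder (r := 2) hV.toLp f,
    hV.coeFn_toLp] with x h1 h2
  exact h1.trans (by rw [h2]; rfl)

lemma packet_mul_conj_packet (z w : Euc d × Euc d) (y : Euc d) :
    packet (1 / 2) z y * (starRingEnd ℂ) (packet (1 / 2) w y) =
      ((Real.exp (-(π / 4) * ‖w.1 - z.1‖ ^ 2) : ℝ) : ℂ) *
        (Complex.exp (-(((2 * π * ⟪w.2 - z.2, y⟫ : ℝ) : ℂ) * Complex.I)) *
          gaussWindow (y - (z.1 + (1 / 2 : ℝ) • (w.1 - z.1)))) := by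
  have h := chirp_mul_packet_mul_conj_packet (1 / 2) (1 / 2) 0 z w y
  have h2 := norm_sq_combine (a := 1 / 2) (b := 1 / 2) (by norm_num)
    (y - (z.1 + (1 / 2 : ℝ) • (w.1 - z.1))) z.1 w.1
  rw [show (1 / 2 : ℝ) / (1 / 2 + 1 / 2) = 1 / 2 by norm_num, sub_add_cancel] at h2
  simp only [zero_mul, Complex.ofReal_zero, neg_zero, Complex.exp_zero, one_mul, h2] at h
  rw [h, gaussWindow, Complex.ofReal_exp, Complex.ofReal_exp, ← Complex.exp_add,
    ← Complex.exp_add, inner_sub_left, inner_sub_left]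
  congr 1
  push_cast
  ring

lemma one_add_rpow_le {s r : ℝ} (hs : 0 ≤ s) (hr : 0 ≤ r) :
    (1 + r) ^ s ≤ 2 ^ (s / 2) * (1 + r ^ 2) ^ (s / 2) := by
  rw [← Real.mul_rpow (by norm_num) (by positivity)]
  have : (1 + r) ^ s = ((1 + r) ^ 2) ^ (s / 2) := by
    rw [← Real.rpow_natCast, ← Real.rpow_mul (by positivity)]
    congr 1
    push_cast
    ring
  rw [this]
  exact Real.rpow_le_rpow (by positivity) (by nlinarith [sq_nonneg (1 - r)]) (by positivity)

lemma wt_mul_wt_le_prod {E F : Type*} [NormedAddCommGroup E] [NormedAddCommGroup F] {s : ℝ}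
    (hs : 0 ≤ s) (a : E) (b : F) : wt s a * wt s b ≤ wt s (a, b) := by
  unfold wt
  rw [← Real.mul_rpow (one_add_norm_pos a).le (one_add_norm_pos b).le]
  refine Real.rpow_le_rpow_of_nonpos (one_add_norm_pos _) ?_ (by linarith)
  have h := mul_nonneg (norm_nonneg a) (norm_nonneg b)
  rw [Prod.norm_mk]
  rcases max_choice ‖a‖ ‖b‖ with h1 | h1 <;> rw [h1] <;> nlinarith [norm_nonneg a, norm_nonneg b]

lemma norm_inner_coh_potential_coh_le {V : Euc d → ℝ} {A : L2Sp d →L[ℂ] L2Sp d}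
    (hA : ∀ f : L2Sp d, (A f : Euc d → ℂ) =ᵐ[volume] fun x => (V x : ℂ) * f x) {s : ℝ} (hs : 0 ≤ s)
    (hVmod : ∃ C : ℝ, ∀ x ξ : Euc d,
      (1 + ‖ξ‖ ^ 2) ^ (s / 2) * ‖STFT (fun x => (V x : ℂ)) x ξ‖ ≤ C) :
    ∃ C : ℝ, 0 ≤ C ∧ ∀ z w : Euc d × Euc d,
      ‖inner ℂ (coh w) (A (coh z))‖ ≤ C * wt s (w - z) := by
  obtain ⟨C, hC⟩ := hVmod
  have hC0 : 0 ≤ C := le_trans (by positivity) (hC 0 0)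
  refine ⟨Real.exp (s ^ 2 / (4 * (π / 4))) * (2 ^ (s / 2) * C), by positivity, fun z w => ?_⟩
  have e : inner ℂ (coh w) (A (coh z)) = ((Real.exp (-(π / 4) * ‖w.1 - z.1‖ ^ 2) : ℝ) : ℂ) *
      STFT (fun x => (V x : ℂ)) (z.1 + (1 / 2 : ℝ) • (w.1 - z.1)) (w.2 - z.2) := by
    rw [inner_coh, STFT, ← integral_const_mul]
    refine integral_congr_ae ?_
    filter_upwards [hA (coh z), coh_ae z] with y h1 h2
    rw [h1, h2, mul_assoc, packet_mul_conj_packet]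
    ring
  rw [e, norm_mul, Complex.norm_real, Real.norm_of_nonneg (Real.exp_pos _).le]
  have h1 := exp_neg_mul_sq_le (c := π / 4) (by positivity) s (norm_nonneg (w.1 - z.1)) hs
  have h2 : ‖STFT (fun x => (V x : ℂ)) (z.1 + (1 / 2 : ℝ) • (w.1 - z.1)) (w.2 - z.2)‖ ≤
      2 ^ (s / 2) * C * wt s (w.2 - z.2) := by
    rw [wt, Real.rpow_neg (one_add_norm_pos _).le, ← div_eq_mul_inv,
      le_div_iff₀ (Real.rpow_pos_of_pos (one_add_norm_pos _) _)]
    calc _ ≤ ‖STFT (fun x => (V x : ℂ)) (z.1 + (1 / 2 : ℝ) • (w.1 - z.1)) (w.2 - z.2)‖ *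
          (2 ^ (s / 2) * (1 + ‖w.2 - z.2‖ ^ 2) ^ (s / 2)) :=
          mul_le_mul_of_nonneg_left (one_add_rpow_le hs (norm_nonneg _)) (norm_nonneg _)
      _ = 2 ^ (s / 2) * ((1 + ‖w.2 - z.2‖ ^ 2) ^ (s / 2) *
          ‖STFT (fun x => (V x : ℂ)) (z.1 + (1 / 2 : ℝ) • (w.1 - z.1)) (w.2 - z.2)‖) := by ring
      _ ≤ _ := mul_le_mul_of_nonneg_left (hC _ _) (by positivity)
  calc _ ≤ (Real.exp (s ^ 2 / (4 * (π / 4))) * wt s (w.1 - z.1)) *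
        (2 ^ (s / 2) * C * wt s (w.2 - z.2)) :=
        mul_le_mul h1 h2 (norm_nonneg _) (mul_nonneg (by positivity) (wt_nonneg _ _))
    _ = Real.exp (s ^ 2 / (4 * (π / 4))) * (2 ^ (s / 2) * C) *
        (wt s (w.1 - z.1) * wt s (w.2 - z.2)) := by ring
    _ ≤ _ := mul_le_mul_of_nonneg_left (wt_mul_wt_le_prod hs _ _) (by positivity)

section Multiplication

variable {V : Euc d → ℝ} {A : L2Sp d →L[ℂ] L2Sp d}
    (hA : ∀ f : L2Sp d, (A f : Euc d → ℂ) =ᵐ[volume] fun x => (V x : ℂ) * f x)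

include hA in
lemma potential_pow_ae (k : ℕ) (f : L2Sp d) :
    ((A ^ k) f : Euc d → ℂ) =ᵐ[volume] fun x => (V x : ℂ) ^ k * f x := by
  induction k with
  | zero => exact .of_forall fun x => by simp
  | succ k ih =>
    filter_upwards [ih, hA ((A ^ k) f)] with x h1 h2
    rw [pow_succ', ContinuousLinearMap.mul_def, ContinuousLinearMap.comp_apply, h2, h1]
    ring

variable {Mul : ℝ → L2Sp d →L[ℂ] L2Sp d}
    (hMul : ∀ (τ : ℝ) (f : L2Sp d),
      (Mul τ f : Euc d → ℂ) =ᵐ[volume] fun x =>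
        Complex.exp (-(((τ * V x : ℝ) : ℂ) * Complex.I)) * f x)

include hMul in
lemma norm_mulExp_le (τ : ℝ) (f : L2Sp d) : ‖Mul τ f‖ ≤ ‖f‖ := by
  rw [← one_mul ‖f‖]
  refine Lp.norm_le_mul_norm_of_ae_le_mul ?_
  filter_upwards [hMul τ f] with x hx
  rw [hx, norm_mul, norm_exp_neg_ofReal_mul_I]

lemma norm_exp_sub_one_sub_le (θ : ℝ) :
    ‖Complex.exp (-((θ : ℂ) * Complex.I)) - 1 + (θ : ℂ) * Complex.I‖ ≤ 3 * θ ^ 2 := by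
  have hn : ‖-((θ : ℂ) * Complex.I)‖ = |θ| := by simp
  rcases le_or_gt |θ| 1 with h | h
  · have := Complex.norm_exp_sub_one_sub_id_le (x := -((θ : ℂ) * Complex.I)) (by rwa [hn])
    rw [hn, sub_neg_eq_add, sq_abs] at this
    nlinarith [sq_nonneg θ]
  · refine (norm_add_le _ _).trans ((add_le_add_left (norm_sub_le _ _) _).trans ?_)
    rw [norm_exp_neg_ofReal_mul_I, ← norm_neg ((θ : ℂ) * Complex.I), hn, norm_one, ← sq_abs]
    nlinarith

include hA hMul in
lemma norm_add_smul_potential_sub_mulExp_le {M : ℝ} (hM : ∀ x, |V x| ≤ M) (τ : ℝ) (f : L2Sp d) :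
    ‖f + (-(τ * Complex.I) : ℂ) • A f - Mul τ f‖ ≤ 3 * M ^ 2 * τ ^ 2 * ‖f‖ := by
  refine Lp.norm_le_mul_norm_of_ae_le_mul ?_
  filter_upwards [hMul τ f, hA f, Lp.coeFn_sub (f + (-(τ * Complex.I) : ℂ) • A f) (Mul τ f),
    Lp.coeFn_add f ((-(τ * Complex.I) : ℂ) • A f), Lp.coeFn_smul (-(τ * Complex.I) : ℂ) (A f)]
    with x h1 h2 h3 h4 h5
  rw [h3, Pi.sub_apply, h4, Pi.add_apply, h5, Pi.smul_apply, h1, h2]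
  have : (f : Euc d → ℂ) x + (-(τ * Complex.I) : ℂ) • ((V x : ℂ) * (f : Euc d → ℂ) x) -
      Complex.exp (-(((τ * V x : ℝ) : ℂ) * Complex.I)) * (f : Euc d → ℂ) x =
      -(Complex.exp (-(((τ * V x : ℝ) : ℂ) * Complex.I)) - 1 +
        ((τ * V x : ℝ) : ℂ) * Complex.I) * (f : Euc d → ℂ) x := by
    push_cast
    rw [smul_eq_mul]
    ring
  rw [this, norm_mul, norm_neg]
  refine mul_le_mul_of_nonneg_right ((norm_exp_sub_one_sub_le _).trans ?_) (norm_nonneg _)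
  have : V x ^ 2 ≤ M ^ 2 := sq_le_sq' (neg_le_of_abs_le (hM x)) (le_of_abs_le (hM x))
  nlinarith [mul_le_mul_of_nonneg_left this (sq_nonneg τ)]

include hA hMul in
lemma hasSum_inner_potential_pow (hVcont : Continuous V) {M : ℝ} (hM : ∀ x, |V x| ≤ M) (τ : ℝ) (h f : L2Sp d) :
    HasSum (fun k : ℕ => (-(τ * Complex.I) : ℂ) ^ k / (k.factorial : ℂ) * inner ℂ h ((A ^ k) f))
      (inner ℂ h (Mul τ f)) := by
  have hi := L2.integrable_inner (𝕜 := ℂ) h f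
  have e1 : inner ℂ h (Mul τ f) = ∫ x, Complex.exp (-(((τ * V x : ℝ) : ℂ) * Complex.I)) *
      inner ℂ ((h : Euc d → ℂ) x) ((f : Euc d → ℂ) x) := by
    rw [L2.inner_def]
    refine integral_congr_ae ?_
    filter_upwards [hMul τ f] with x hx
    rw [hx, RCLike.inner_apply, RCLike.inner_apply]
    ring
  have e2 : ∀ k : ℕ, (-(τ * Complex.I) : ℂ) ^ k / (k.factorial : ℂ) * inner ℂ h ((A ^ k) f) =
      ∫ x, (-(((τ * V x : ℝ) : ℂ) * Complex.I)) ^ k / (k.factorial : ℂ) *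
        inner ℂ ((h : Euc d → ℂ) x) ((f : Euc d → ℂ) x) := by
    intro k
    rw [L2.inner_def, ← integral_const_mul]
    refine integral_congr_ae ?_
    filter_upwards [potential_pow_ae hA k f] with x hx
    rw [hx, RCLike.inner_apply, RCLike.inner_apply]
    have : (-(((τ * V x : ℝ) : ℂ) * Complex.I)) ^ k = (-(τ * Complex.I) : ℂ) ^ k * (V x : ℂ) ^ k := by
      rw [← mul_pow]
      congr 1
      push_cast
      ring
    rw [this]
    ring
  have hsum : ∀ x, HasSum (fun k : ℕ => (|τ| * M) ^ k / (k.factorial : ℝ) *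
      ‖inner ℂ ((h : Euc d → ℂ) x) ((f : Euc d → ℂ) x)‖)
      (Real.exp (|τ| * M) * ‖inner ℂ ((h : Euc d → ℂ) x) ((f : Euc d → ℂ) x)‖) := by
    intro x
    have := NormedSpace.expSeries_div_hasSum_exp (|τ| * M)
    rw [← Real.exp_eq_exp_ℝ] at this
    exact this.mul_right _
  rw [e1]
  simp_rw [e2]
  refine hasSum_integral_of_dominated_convergence (fun (k : ℕ) x => (|τ| * M) ^ k / (k.factorial : ℝ) *
      ‖inner ℂ ((h : Euc d → ℂ) x) ((f : Euc d → ℂ) x)‖) (fun k => ?_)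
      (fun k => .of_forall fun x => ?_) (.of_forall fun x => (hsum x).summable) ?_
      (.of_forall fun x => ?_)
  · refine AEStronglyMeasurable.mul ?_ hi.aestronglyMeasurable
    exact Continuous.aestronglyMeasurable (by fun_prop)
  · rw [norm_mul, norm_div, norm_pow, norm_neg, norm_mul, Complex.norm_I, mul_one,
      Complex.norm_real, Real.norm_eq_abs, abs_mul, Complex.norm_natCast]
    gcongr
    exact hM x
  · simp_rw [fun x => (hsum x).tsum_eq]
    exact hi.norm.const_mul _
  · have := NormedSpace.expSeries_div_hasSum_exp (-(((τ * V x : ℝ) : ℂ) * Complex.I))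
    rw [← Complex.exp_eq_exp_ℂ] at this
    exact this.mul_right _

end Multiplication

end Potential

section SchurBounds

variable {d : ℕ}

lemma freeFlow_sub (r : ℝ) (z w : Euc d × Euc d) :
    freeFlow r (z - w) = freeFlow r z - freeFlow r w := by
  ext1
  · simp only [freeFlow, Prod.fst_sub, Prod.snd_sub]
    module
  · rfl

lemma freeFlow_freeFlow_neg (r : ℝ) (z : Euc d × Euc d) : freeFlow r (freeFlow (-r) z) = z := by
  ext1
  · simp only [freeFlow]
    module
  · rfl

lemma norm_freeFlow_le (r : ℝ) (z : Euc d × Euc d) :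
    ‖freeFlow r z‖ ≤ (1 + 2 * π * |r|) * ‖z‖ := by
  have h0 : 0 ≤ 2 * π * |r| * ‖z‖ := by positivity
  refine max_le ?_ ?_
  · refine (norm_add_le _ _).trans ?_
    rw [norm_smul, Real.norm_eq_abs, abs_mul, abs_of_nonneg (by positivity : 0 ≤ 2 * π), add_mul,
      one_mul]
    have h1 := norm_fst_le z
    have h2 := norm_snd_le z
    gcongr
  · have := norm_snd_le z
    simp only [freeFlow]
    linarith

lemma wt_freeFlow_le {s R : ℝ} (hs : 0 ≤ s) {r : ℝ} (hr : |r| ≤ R) (z : Euc d × Euc d) :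
    wt s (freeFlow r z) ≤ (1 + 2 * π * R) ^ s * wt s z := by
  have hR : 0 ≤ R := (abs_nonneg r).trans hr
  refine wt_le_of_le hs (by positivity) ?_
  have h1 : freeFlow (-r) (freeFlow r z) = z := by
    simpa using freeFlow_freeFlow_neg (-r) z
  have h2 := norm_freeFlow_le (-r) (freeFlow r z)
  rw [h1, abs_neg] at h2
  have h3 : (1 + 2 * π * |r|) * ‖freeFlow r z‖ ≤ (1 + 2 * π * R) * ‖freeFlow r z‖ := by gcongr
  have h4 : 0 ≤ 2 * π * R := by positivity
  linarith

variable (F : L2Sp d ≃ₗᵢ[ℂ] L2Sp d)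
    (hF : ∀ f : L2Sp d, Integrable (f : Euc d → ℂ) →
      (F f : Euc d → ℂ) =ᵐ[volume] fun ξ =>
        ∫ x, Complex.exp (-(((2 * π * ⟪ξ, x⟫ : ℝ) : ℂ) * Complex.I)) * f x)

include hF in
lemma norm_inner_coh_comp_le {s : ℝ} (hs : 2 * d < s) (T₁ : L2Sp d →L[ℂ] L2Sp d) {f : L2Sp d}
    {w w₀ z₀ : Euc d × Euc d} {C₁ C₂ : ℝ} (hC₁ : 0 ≤ C₁) (hC₂ : 0 ≤ C₂)
    (h1 : ∀ a, ‖inner ℂ (coh w) (T₁ (coh a))‖ ≤ C₁ * wt s (a - w₀))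
    (h2 : ∀ a, ‖inner ℂ (coh a) f‖ ≤ C₂ * wt s (a - z₀)) :
    ‖inner ℂ (coh w) (T₁ f)‖ ≤ C₁ * C₂ * schurConst d s * wt s (w₀ - z₀) := by
  rw [← ContinuousLinearMap.adjoint_inner_left, mul_comm C₁]
  refine norm_inner_le_of_wt F hF hs hC₂ h2 (fun a => ?_) hC₁
  rw [ContinuousLinearMap.adjoint_inner_right, norm_inner_symm]
  exact h1 a

/-- Off-diagonal decay of the coherent-state matrix of `T`, normalized so that bounds are
submultiplicative. -/
def SchurBound (s : ℝ) (T : L2Sp d →L[ℂ] L2Sp d) (b : ℝ) : Prop :=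
  ∀ z w, schurConst d s * ‖inner ℂ (coh w) (T (coh z))‖ ≤ b * wt s (w - z)

lemma SchurBound.le_div {s : ℝ} {T : L2Sp d →L[ℂ] L2Sp d} {b : ℝ} (h : SchurBound s T b)
    (z w : Euc d × Euc d) :
    ‖inner ℂ (coh w) (T (coh z))‖ ≤ b / schurConst d s * wt s (w - z) := by
  rw [div_mul_eq_mul_div, le_div_iff₀ (schurConst_pos d s), mul_comm]
  exact h z w

lemma SchurBound.add {s : ℝ} {T₁ T₂ : L2Sp d →L[ℂ] L2Sp d} {b₁ b₂ : ℝ} (h₁ : SchurBound s T₁ b₁)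
    (h₂ : SchurBound s T₂ b₂) : SchurBound s (T₁ + T₂) (b₁ + b₂) := fun z w => by
  rw [add_apply, inner_add_right, add_mul]
  refine (mul_le_mul_of_nonneg_left (norm_add_le _ _) (schurConst_pos d s).le).trans ?_
  rw [mul_add]
  exact add_le_add (h₁ z w) (h₂ z w)

lemma SchurBound.mono {s : ℝ} {T : L2Sp d →L[ℂ] L2Sp d} {b b' : ℝ} (h : SchurBound s T b)
    (hb : b ≤ b') : SchurBound s T b' := fun z w =>
  (h z w).trans (mul_le_mul_of_nonneg_right hb (wt_nonneg _ _))

include hF in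
lemma SchurBound.comp {s : ℝ} (hs : 2 * d < s) {T₁ T₂ : L2Sp d →L[ℂ] L2Sp d} {b₁ b₂ : ℝ}
    (h₁ : SchurBound s T₁ b₁) (h₂ : SchurBound s T₂ b₂) (hb₁ : 0 ≤ b₁) (hb₂ : 0 ≤ b₂) :
    SchurBound s (T₁.comp T₂) (b₁ * b₂) := fun z w => by
  have hK := schurConst_pos d s
  have := norm_inner_coh_comp_le F hF hs T₁ (div_nonneg hb₁ hK.le) (div_nonneg hb₂ hK.le)
    (w := w) (w₀ := w) (fun a => (h₁.le_div a w).trans_eq (by rw [wt_sub_comm])) (h₂.le_div z)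
  refine (mul_le_mul_of_nonneg_left this hK.le).trans_eq ?_
  field_simp

include hF in
lemma SchurBound.pow_succ {s : ℝ} (hs : 2 * d < s) {T : L2Sp d →L[ℂ] L2Sp d} {b : ℝ}
    (h : SchurBound s T b) (hb : 0 ≤ b) (k : ℕ) : SchurBound s (T ^ (k + 1)) (b ^ (k + 1)) := by
  induction k with
  | zero => simpa using h
  | succ k ih =>
    rw [_root_.pow_succ' T (k + 1), _root_.pow_succ' b (k + 1)]
    exact h.comp F hF hs ih hb (by positivity)

variable (U₀ : ℝ → L2Sp d →L[ℂ] L2Sp d)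
    (hU₀ : ∀ (τ : ℝ) (f : L2Sp d),
      (F (U₀ τ f) : Euc d → ℂ) =ᵐ[volume] fun ξ =>
        Complex.exp (-(((2 * π ^ 2 * τ * ‖ξ‖ ^ 2 : ℝ) : ℂ) * Complex.I)) *
          (F f : Euc d → ℂ) ξ)

include hF hU₀ in
lemma schurBound_one {s : ℝ} (hs : 0 ≤ s) :
    ∃ b : ℝ, 0 ≤ b ∧ SchurBound s (1 : L2Sp d →L[ℂ] L2Sp d) b := by
  obtain ⟨C, hC, h⟩ := norm_inner_coh_free_coh_le F hF U₀ hU₀ hs le_rfl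
  have hK := (schurConst_pos d s).le
  refine ⟨schurConst d s * C, mul_nonneg hK hC, fun z w => ?_⟩
  have := h 0 (by simp) z w
  rw [free_zero F U₀ hU₀] at this
  rw [mul_assoc]
  simpa [freeFlow] using mul_le_mul_of_nonneg_left this hK

include hF hU₀ in
lemma schurBound_conj {s : ℝ} (hs : 2 * d < s) {A : L2Sp d →L[ℂ] L2Sp d} {C : ℝ} (hC : 0 ≤ C)
    (hA : ∀ z w : Euc d × Euc d, ‖inner ℂ (coh w) (A (coh z))‖ ≤ C * wt s (w - z)) {R : ℝ}
    (hR : 0 ≤ R) :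
    ∃ b : ℝ, 0 ≤ b ∧ ∀ r, |r| ≤ R → SchurBound s ((U₀ (-r)).comp (A.comp (U₀ r))) b := by
  have hs0 : 0 ≤ s := le_trans (by positivity) hs.le
  obtain ⟨C₀, hC₀, h⟩ := norm_inner_coh_free_coh_le F hF U₀ hU₀ hs0 hR
  have hK := (schurConst_pos d s).le
  refine ⟨schurConst d s * (C * C₀ * schurConst d s * C₀ * schurConst d s * (1 + 2 * π * R) ^ s),
    by positivity, fun r hr z w => ?_⟩
  rw [mul_assoc]
  refine mul_le_mul_of_nonneg_left ?_ hK
  have h1 : ∀ a, ‖inner ℂ (coh a) (A (U₀ r (coh z)))‖ ≤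
      C * C₀ * schurConst d s * wt s (a - freeFlow r z) := fun a =>
    norm_inner_coh_comp_le F hF hs A hC hC₀ (fun b => (hA b a).trans_eq (by rw [wt_sub_comm]))
      (fun b => h r hr z b)
  have h2 := norm_inner_le_of_wt F hF hs (by positivity) h1 (fun a => h r hr w a) hC₀
  rw [ContinuousLinearMap.comp_apply, ContinuousLinearMap.comp_apply,
    ← inner_free_left F U₀ hU₀]
  refine h2.trans ?_
  rw [← freeFlow_sub, mul_assoc _ (_ ^ s)]
  exact mul_le_mul_of_nonneg_left (wt_freeFlow_le hs0 hr _) (by positivity)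

include hU₀ in
lemma conj_free_pow (A : L2Sp d →L[ℂ] L2Sp d) (r : ℝ) (k : ℕ) :
    ((U₀ (-r)).comp (A.comp (U₀ r))) ^ k = (U₀ (-r)).comp ((A ^ k).comp (U₀ r)) := by
  induction k with
  | zero =>
    ext1 f
    have := free_neg_apply F U₀ hU₀ (-r) f
    rw [neg_neg] at this
    simp [this]
  | succ k ih =>
    rw [_root_.pow_succ', ih, _root_.pow_succ']
    ext1 f
    simp only [ContinuousLinearMap.mul_def, ContinuousLinearMap.comp_apply]
    rw [free_neg_apply F U₀ hU₀]

variable {V : Euc d → ℝ} {A : L2Sp d →L[ℂ] L2Sp d}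
    (hA : ∀ f : L2Sp d, (A f : Euc d → ℂ) =ᵐ[volume] fun x => (V x : ℂ) * f x)
    {Mul : ℝ → L2Sp d →L[ℂ] L2Sp d}
    (hMul : ∀ (τ : ℝ) (f : L2Sp d),
      (Mul τ f : Euc d → ℂ) =ᵐ[volume] fun x =>
        Complex.exp (-(((τ * V x : ℝ) : ℂ) * Complex.I)) * f x)

include hF hU₀ hA hMul in
lemma schurBound_conj_mulExp_sub_one {s : ℝ} (hs : 2 * d < s) (hVcont : Continuous V) {M : ℝ}
    (hM : ∀ x, |V x| ≤ M) {b r : ℝ} (hb : 0 ≤ b)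
    (hAr : SchurBound s ((U₀ (-r)).comp (A.comp (U₀ r))) b) (τ : ℝ) :
    SchurBound s ((U₀ (-r)).comp ((Mul τ).comp (U₀ r)) - 1) (Real.exp (|τ| * b) - 1) := by
  intro z w
  have hK := schurConst_pos d s
  have h1 := hasSum_inner_potential_pow hA hMul hVcont hM τ (U₀ r (coh w)) (U₀ r (coh z))
  rw [← hasSum_nat_add_iff' 1] at h1
  have e1 : inner ℂ (U₀ r (coh w)) (Mul τ (U₀ r (coh z))) -
      ∑ i ∈ Finset.range 1, (-(τ * Complex.I) : ℂ) ^ i / (i.factorial : ℂ) *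
        inner ℂ (U₀ r (coh w)) ((A ^ i) (U₀ r (coh z))) =
      inner ℂ (coh w) (((U₀ (-r)).comp ((Mul τ).comp (U₀ r)) - 1) (coh z)) := by
    rw [sub_apply, inner_sub_right, ContinuousLinearMap.comp_apply,
      ContinuousLinearMap.comp_apply, ← inner_free_left F U₀ hU₀]
    simp [inner_free_free_self F U₀ hU₀]
  rw [e1] at h1
  have h2 := NormedSpace.expSeries_div_hasSum_exp (|τ| * b)
  rw [← Real.exp_eq_exp_ℝ, ← hasSum_nat_add_iff' 1] at h2
  simp only [Finset.range_one, Finset.sum_singleton, pow_zero, Nat.factorial_zero, Nat.cast_one,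
    div_one] at h2
  have h3 := h2.mul_right (wt s (w - z) / schurConst d s)
  rw [← h1.tsum_eq]
  have h4 := tsum_of_norm_bounded h3 (f := fun k => (-(τ * Complex.I) : ℂ) ^ (k + 1) /
    ((k + 1).factorial : ℂ) * inner ℂ (U₀ r (coh w)) ((A ^ (k + 1)) (U₀ r (coh z)))) (fun k => ?_)
  · refine (mul_le_mul_of_nonneg_left h4 hK.le).trans_eq ?_
    field_simp
  · have h5 := (hAr.pow_succ F hF hs hb k).le_div z w
    rw [conj_free_pow F U₀ hU₀, ContinuousLinearMap.comp_apply, ContinuousLinearMap.comp_apply,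
      ← inner_free_left F U₀ hU₀] at h5
    rw [norm_mul, norm_div, norm_pow, norm_neg, norm_mul, Complex.norm_I, mul_one,
      Complex.norm_real, Real.norm_eq_abs, Complex.norm_natCast]
    refine (mul_le_mul_of_nonneg_left h5 (by positivity)).trans_eq ?_
    rw [mul_pow]
    ring

include hF hU₀ hA hMul in
lemma exists_interaction_factor {s : ℝ} (hs : 2 * d < s) (hVcont : Continuous V) {M : ℝ}
    (hM : ∀ x, |V x| ≤ M) {b R : ℝ} (hb : 0 ≤ b)
    (hAr : ∀ r, |r| ≤ R → SchurBound s ((U₀ (-r)).comp (A.comp (U₀ r))) b) (τ : ℝ) (m : ℕ)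
    (hm : m * |τ| ≤ R) :
    ∃ P : L2Sp d →L[ℂ] L2Sp d, ((U₀ τ).comp (Mul τ)) ^ m = (U₀ (m * τ)).comp P ∧
      SchurBound s (P - 1) (Real.exp (m * |τ| * b) - 1) := by
  induction m with
  | zero =>
    refine ⟨1, ?_, fun z w => by simp⟩
    ext1 f
    simp [free_zero F U₀ hU₀]
  | succ m ih =>
    push_cast at hm
    obtain ⟨P, hP1, hP2⟩ := ih (by linarith [abs_nonneg τ])
    set Q := (U₀ (-(m * τ))).comp ((Mul τ).comp (U₀ (m * τ))) with hQ
    have hQ2 : SchurBound s (Q - 1) (Real.exp (|τ| * b) - 1) :=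
      schurBound_conj_mulExp_sub_one F hF U₀ hU₀ hA hMul hs hVcont hM hb
        (hAr _ (by
          rw [abs_mul, Nat.abs_cast]
          linarith [abs_nonneg τ])) τ
    refine ⟨Q.comp P, ?_, ?_⟩
    · rw [_root_.pow_succ', hP1]
      ext1 f
      have e : ((m + 1 : ℕ) : ℝ) * τ = τ + m * τ := by
        push_cast
        ring
      simp only [ContinuousLinearMap.mul_def, hQ, ContinuousLinearMap.comp_apply, e,
        free_add F U₀ hU₀ τ]
      rw [free_neg_apply F U₀ hU₀]
    · have e : Q.comp P - 1 = (Q - 1).comp (P - 1) + ((Q - 1) + (P - 1)) := by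
        ext1 f
        simp
        abel
      have h1 : 0 ≤ Real.exp (|τ| * b) - 1 := by
        rw [sub_nonneg, Real.one_le_exp_iff]
        positivity
      have h2 : 0 ≤ Real.exp (m * |τ| * b) - 1 := by
        rw [sub_nonneg, Real.one_le_exp_iff]
        positivity
      rw [e]
      refine ((hQ2.comp F hF hs hP2 h1 h2).add (hQ2.add hP2)).mono (le_of_eq ?_)
      have : ((m + 1 : ℕ) : ℝ) * |τ| * b = |τ| * b + m * |τ| * b := by
        push_cast
        ring
      rw [this, Real.exp_add]
      ring

include hF hU₀ hMul in
/-- Uniform concentration of the coherent-state matrices of the Trotter approximations along the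
free flow. -/
lemma trotter_matrix_bound {s : ℝ} (hs : 2 * d < s) (hVcont : Continuous V) {M : ℝ}
    (hM : ∀ x, |V x| ≤ M)
    (hVmod : ∃ C : ℝ, ∀ x ξ : Euc d,
      (1 + ‖ξ‖ ^ 2) ^ (s / 2) * ‖STFT (fun x => (V x : ℂ)) x ξ‖ ≤ C) (t : ℝ) :
    ∃ C : ℝ, 0 ≤ C ∧ ∀ n : ℕ, 1 ≤ n → ∀ z w : Euc d × Euc d,
      ‖inner ℂ (coh w) ((((U₀ (t / n)).comp (Mul (t / n))) ^ n) (coh z))‖ ≤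
        C * wt s (freeFlow (-t) w - z) := by
  have hs0 : 0 ≤ s := le_trans (by positivity) hs.le
  obtain ⟨A, hA⟩ := exists_potentialOp hVcont hM
  obtain ⟨CA, hCA, hA2⟩ := norm_inner_coh_potential_coh_le hA hs0 hVmod
  obtain ⟨b, hb, hAr⟩ := schurBound_conj F hF U₀ hU₀ hs hCA hA2 (abs_nonneg t)
  obtain ⟨b₁, hb₁, h1⟩ := schurBound_one F hF U₀ hU₀ hs0
  obtain ⟨C₀, hC₀, hfree⟩ := norm_inner_coh_free_coh_le F hF U₀ hU₀ hs0 (abs_nonneg t)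
  have hK := (schurConst_pos d s).le
  have hE : 0 ≤ Real.exp (|t| * b) - 1 := by
    rw [sub_nonneg, Real.one_le_exp_iff]
    positivity
  refine ⟨C₀ * (1 + 2 * π * |t|) ^ s * ((Real.exp (|t| * b) - 1 + b₁) / schurConst d s) *
    schurConst d s, by positivity, fun n hn z w => ?_⟩
  have hn0 : (n : ℝ) ≠ 0 := Nat.cast_ne_zero.2 (by omega)
  have hnt : (n : ℝ) * |t / n| = |t| := by
    rw [abs_div, Nat.abs_cast]
    field_simp
  obtain ⟨P, hP1, hP2⟩ := exists_interaction_factor F hF U₀ hU₀ hA hMul hs hVcont hM hb hAr (t / n)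
    n hnt.le
  rw [hnt] at hP2
  have hP3 := hP2.add h1
  rw [sub_add_cancel] at hP3
  rw [hP1, mul_div_cancel₀ t hn0, ContinuousLinearMap.comp_apply]
  refine norm_inner_coh_comp_le F hF hs (U₀ t) (by positivity) (by positivity) (fun a => ?_)
    (hP3.le_div z)
  refine (hfree t le_rfl a w).trans ?_
  have e : w - freeFlow t a = freeFlow t (freeFlow (-t) w - a) := by
    rw [freeFlow_sub, freeFlow_freeFlow_neg]
  rw [e, mul_assoc, wt_sub_comm s a]
  exact mul_le_mul_of_nonneg_left (wt_freeFlow_le hs0 le_rfl _) hC₀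

end SchurBounds

section Kernel

variable {d : ℕ}

section Weights

lemma lintegral_wt_sub (s : ℝ) (c : Euc d) :
    ∫⁻ a, ENNReal.ofReal (wt s (a - c)) = ∫⁻ a : Euc d, ENNReal.ofReal (wt s a) :=
  lintegral_sub_right_eq_self (fun a : Euc d => ENNReal.ofReal (wt s a)) c

lemma lintegral_wt_ne_top {s : ℝ} (hs : d < s) :
    ∫⁻ a : Euc d, ENNReal.ofReal (wt s a) ≠ ⊤ := by
  have hs' : (Module.finrank ℝ (Euc d) : ℝ) < s := by rwa [finrank_euclideanSpace_fin]
  rw [← ofReal_integral_eq_lintegral_ofReal (integrable_wt volume hs')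
    (.of_forall fun a => wt_nonneg s a)]
  exact ENNReal.ofReal_ne_top

lemma lintegral_wt_mul_wt_le {s : ℝ} (hs : d < s) (z w : Euc d) :
    ∫⁻ a, ENNReal.ofReal (wt s (a - z)) * ENNReal.ofReal (wt s (a - w)) ≤
      ENNReal.ofReal (2 ^ s * (2 * ∫ a : Euc d, wt s a)) * ENNReal.ofReal (wt s (w - z)) := by
  have hs' : (Module.finrank ℝ (Euc d) : ℝ) < s := by rwa [finrank_euclideanSpace_fin]
  simp_rw [← ENNReal.ofReal_mul (wt_nonneg s _)]
  rw [← ofReal_integral_eq_lintegral_ofReal (integrable_wt_mul_wt volume hs' z w)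
    (.of_forall fun a => mul_nonneg (wt_nonneg s _) (wt_nonneg s _)),
    ← ENNReal.ofReal_mul (mul_nonneg (by positivity)
      (mul_nonneg two_pos.le (integral_nonneg fun a => wt_nonneg s a)))]
  exact ENNReal.ofReal_le_ofReal (integral_wt_mul_wt_le volume hs' z w)

lemma lintegral_wt_add_smul {s : ℝ} (hs : d < s) {r : ℝ} (hr : r ≠ 0) (c : Euc d) :
    ∫⁻ a, ENNReal.ofReal (wt s (c + r • a)) =
      ENNReal.ofReal (|(r ^ d)⁻¹| * ∫ a : Euc d, wt s a) := by
  have hs' : (Module.finrank ℝ (Euc d) : ℝ) < s := by rwa [finrank_euclideanSpace_fin]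
  have hi : Integrable fun a : Euc d => wt s (c + a) := (integrable_wt volume hs').comp_add_left c
  rw [← ofReal_integral_eq_lintegral_ofReal (hi.comp_smul hr)
    (.of_forall fun a => wt_nonneg s _)]
  congr 1
  rw [Measure.integral_comp_smul volume (fun a : Euc d => wt s (c + a)), integral_add_left_eq_self,
    finrank_euclideanSpace_fin, smul_eq_mul]

/-- Majorant on pairs of phase-space points for the coherent-state expansion of an integral
kernel near `p`. -/
def phaseWeight (s t : ℝ) (p : Euc d × Euc d) (q : (Euc d × Euc d) × (Euc d × Euc d)) : ℝ :=
  wt s (freeFlow (-t) q.1 - q.2) * (wt (s / 2) (q.1.1 - p.1) * wt (s / 2) (q.2.1 - p.2))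

lemma phaseWeight_nonneg (s t : ℝ) (p : Euc d × Euc d) (q : (Euc d × Euc d) × (Euc d × Euc d)) :
    0 ≤ phaseWeight s t p q :=
  mul_nonneg (wt_nonneg _ _) (mul_nonneg (wt_nonneg _ _) (wt_nonneg _ _))

lemma continuous_phaseWeight (s t : ℝ) (p : Euc d × Euc d) : Continuous (phaseWeight s t p) := by
  have h1 := continuous_wt (E := Euc d × Euc d) s
  have h2 := continuous_wt (E := Euc d) (s / 2)
  unfold phaseWeight freeFlow
  fun_prop

lemma exists_lintegral_phaseWeight_le {s t : ℝ} (hs : 2 * d < s) (ht : t ≠ 0) :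
    ∃ K : ℝ≥0∞, K ≠ ⊤ ∧ ∀ p : Euc d × Euc d, ∫⁻ q, ENNReal.ofReal (phaseWeight s t p q) ≤ K := by
  have hs2 : (d : ℝ) < s / 2 := by linarith
  have hs0 : 0 ≤ s := le_trans (by positivity) hs.le
  have hr : 2 * π * (-t) ≠ 0 := by
    have := pi_ne_zero
    simp [ht]
  set Θ : Euc d → ℝ≥0∞ := fun a => ENNReal.ofReal (wt (s / 2) a) with hΘ
  have hΘm : Measurable Θ := (continuous_wt (s / 2)).measurable.ennreal_ofReal
  set I : ℝ≥0∞ := ∫⁻ a : Euc d, Θ a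
  set K₁ : ℝ≥0∞ := ENNReal.ofReal (2 ^ (s / 2) * (2 * ∫ a : Euc d, wt (s / 2) a))
  set K₂ : ℝ≥0∞ := ENNReal.ofReal (|((2 * π * (-t)) ^ d)⁻¹| * ∫ a : Euc d, wt (s / 2) a)
  have hI : I ≠ ⊤ := lintegral_wt_ne_top hs2
  have hsub : ∀ c, ∫⁻ a, Θ (a - c) = I := lintegral_wt_sub _
  refine ⟨I * K₁ * K₂ * I, by finiteness, fun p => ?_⟩
  have hle : ∀ q : (Euc d × Euc d) × (Euc d × Euc d), ENNReal.ofReal (phaseWeight s t p q) ≤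
      Θ (q.1.1 - p.1) * (Θ (q.2.1 - (q.1.1 + (2 * π * (-t)) • q.1.2)) * Θ (q.2.1 - p.2) *
        Θ (q.2.2 - q.1.2)) := by
    intro q
    simp only [hΘ]
    simp_rw [← ENNReal.ofReal_mul (wt_nonneg _ _), ← ENNReal.ofReal_mul (mul_nonneg (wt_nonneg _ _)
      (wt_nonneg _ _)), ← ENNReal.ofReal_mul (wt_nonneg _ _)]
    refine ENNReal.ofReal_le_ofReal ?_
    rw [phaseWeight]
    refine (mul_le_mul_of_nonneg_right (wt_prod_le hs0 _)
      (mul_nonneg (wt_nonneg _ _) (wt_nonneg _ _))).trans_eq ?_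
    simp only [Prod.fst_sub, Prod.snd_sub, freeFlow]
    rw [wt_sub_comm _ (q.1.1 + _), wt_sub_comm _ q.1.2]
    ring
  refine (lintegral_mono hle).trans ?_
  rw [Measure.volume_eq_prod, lintegral_prod _ (by fun_prop), Measure.volume_eq_prod,
    lintegral_prod _ (by fun_prop)]
  have h1 : ∀ x b : Euc d, ∫⁻ z : Euc d × Euc d, Θ (x - p.1) *
      (Θ (z.1 - (x + (2 * π * (-t)) • b)) * Θ (z.1 - p.2) * Θ (z.2 - b))
        ∂((volume : Measure (Euc d)).prod volume) ≤
      Θ (x - p.1) * (I * K₁) * Θ (p.2 - x + (-(2 * π * (-t))) • b) := by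
    intro x b
    rw [lintegral_const_mul _ (by fun_prop), lintegral_prod _ (by fun_prop)]
    simp only
    simp_rw [lintegral_const_mul _ (show Measurable fun a => Θ (a - b) by fun_prop), hsub]
    rw [lintegral_mul_const _ (by fun_prop)]
    have := lintegral_wt_mul_wt_le hs2 (x + (2 * π * (-t)) • b) p.2
    calc _ ≤ Θ (x - p.1) * ((K₁ * ENNReal.ofReal (wt (s / 2) (p.2 - (x + (2 * π * (-t)) • b)))) *
          I) := by
          gcongr
      _ = _ := by
          rw [show p.2 - (x + (2 * π * (-t)) • b) = p.2 - x + (-(2 * π * (-t))) • b by module]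
          ring
  calc _ ≤ ∫⁻ x, ∫⁻ b, Θ (x - p.1) * (I * K₁) * Θ (p.2 - x + (-(2 * π * (-t))) • b) :=
        lintegral_mono fun x => lintegral_mono fun b => h1 x b
    _ = ∫⁻ x, Θ (x - p.1) * (I * K₁ * K₂) := by
        refine lintegral_congr fun x => ?_
        rw [lintegral_const_mul _ (by fun_prop), lintegral_wt_add_smul hs2 (neg_ne_zero.2 hr),
          mul_assoc]
        congr 3
        rw [neg_pow, mul_inv, abs_mul]
        simp
    _ ≤ _ := by
        rw [lintegral_mul_const _ (by fun_prop), lintegral_wt_sub, mul_comm]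

lemma exists_integral_phaseWeight_le {s t : ℝ} (hs : 2 * d < s) (ht : t ≠ 0) :
    ∃ K : ℝ, 0 ≤ K ∧ ∀ p : Euc d × Euc d, Integrable (phaseWeight s t p) ∧
      ∫ q, phaseWeight s t p q ≤ K := by
  obtain ⟨K, hK, h⟩ := exists_lintegral_phaseWeight_le (d := d) hs ht
  refine ⟨K.toReal, ENNReal.toReal_nonneg, fun p => ⟨⟨(continuous_phaseWeight s t
    p).aestronglyMeasurable, ?_⟩, ?_⟩⟩
  · rw [hasFiniteIntegral_iff_ofReal (.of_forall fun q => phaseWeight_nonneg s t p q)]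
    exact (h p).trans_lt hK.lt_top
  · rw [integral_eq_lintegral_of_nonneg_ae (.of_forall fun q => phaseWeight_nonneg s t p q)
      (continuous_phaseWeight s t p).aestronglyMeasurable]
    exact ENNReal.toReal_mono hK (h p)

end Weights

/-- The rank-one integral kernel built from two coherent states. -/
def packetPair (p : Euc d × Euc d) (q : (Euc d × Euc d) × (Euc d × Euc d)) : ℂ :=
  packet (1 / 2) q.1 p.1 * (starRingEnd ℂ) (packet (1 / 2) q.2 p.2)

lemma continuous_packetPair_uncurry :
    Continuous fun r : (Euc d × Euc d) × ((Euc d × Euc d) × (Euc d × Euc d)) =>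
      packetPair r.1 r.2 := by
  refine ((continuous_packet_uncurry (1 / 2)).comp (f := fun r : (Euc d × Euc d) ×
    ((Euc d × Euc d) × (Euc d × Euc d)) => (r.2.1, r.1.1)) (by fun_prop)).mul
    (Complex.continuous_conj.comp ((continuous_packet_uncurry (1 / 2)).comp (f := fun r :
      (Euc d × Euc d) × ((Euc d × Euc d) × (Euc d × Euc d)) => (r.2.2, r.1.2)) (by fun_prop)))

lemma continuous_packetPair (p : Euc d × Euc d) : Continuous (packetPair p) :=
  ((continuous_packet_left (1 / 2) p.1).comp continuous_fst).mul (Complex.continuous_conj.comp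
    ((continuous_packet_left (1 / 2) p.2).comp continuous_snd))

lemma norm_packet_le_wt {N : ℝ} (hN : 0 ≤ N) : ∃ C : ℝ, 0 ≤ C ∧ ∀ (z : Euc d × Euc d) (y y₀ : Euc d),
    ‖y - y₀‖ ≤ 1 → ‖packet (1 / 2) z y‖ ≤ C * wt N (z.1 - y₀) := by
  refine ⟨Real.exp (N ^ 2 / (4 * (π / 2))) * 2 ^ N, by positivity, fun z y y₀ hy => ?_⟩
  have h1 := exp_neg_mul_sq_le (c := π / 2) (by positivity) N (norm_nonneg (y - z.1)) hN
  rw [norm_packet, show -π * (1 / 2) * ‖y - z.1‖ ^ 2 = -(π / 2) * ‖y - z.1‖ ^ 2 by ring, mul_assoc]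
  refine h1.trans (mul_le_mul_of_nonneg_left ?_ (Real.exp_pos _).le)
  refine wt_le_of_le (a := z.1 - y₀) (b := y - z.1) hN two_pos.le ?_
  have := norm_sub_le_norm_sub_add_norm_sub z.1 y y₀
  rw [norm_sub_rev z.1 y] at this
  linarith [norm_nonneg (y - z.1)]

lemma norm_packetPair_le_wt {N : ℝ} (hN : 0 ≤ N) :
    ∃ C : ℝ, 0 ≤ C ∧ ∀ p p₀ : Euc d × Euc d, ‖p - p₀‖ ≤ 1 → ∀ q,
      ‖packetPair p q‖ ≤ C * (wt N (q.1.1 - p₀.1) * wt N (q.2.1 - p₀.2)) := by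
  obtain ⟨C, hC, h⟩ := norm_packet_le_wt (d := d) hN
  refine ⟨C * C, mul_nonneg hC hC, fun p p₀ hp q => ?_⟩
  rw [packetPair, norm_mul, RCLike.norm_conj, mul_mul_mul_comm]
  exact mul_le_mul (h _ _ _ ((norm_fst_le (p - p₀)).trans hp))
    (h _ _ _ ((norm_snd_le (p - p₀)).trans hp)) (norm_nonneg _) (mul_nonneg hC (wt_nonneg _ _))

/-- Decay of the coherent-state matrix of `T` away from the graph of the free flow at time `t`. -/
def FlowDecay (s t : ℝ) (T : L2Sp d →L[ℂ] L2Sp d) (C : ℝ) : Prop :=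
  ∀ z w, ‖inner ℂ (coh w) (T (coh z))‖ ≤ C * wt s (freeFlow (-t) w - z)

/-- The integral kernel of `T` obtained from its coherent-state matrix. -/
def opKernel (T : L2Sp d →L[ℂ] L2Sp d) (p : Euc d × Euc d) : ℂ :=
  ∫ q : (Euc d × Euc d) × (Euc d × Euc d), inner ℂ (coh q.1) (T (coh q.2)) * packetPair p q

lemma continuous_inner_coh_apply_coh (T : L2Sp d →L[ℂ] L2Sp d) :
    Continuous fun q : (Euc d × Euc d) × (Euc d × Euc d) =>
      inner ℂ (coh q.1) (T (coh q.2)) :=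
  (continuous_coh.comp continuous_fst).inner
    (T.continuous.comp (continuous_coh.comp continuous_snd))

lemma FlowDecay.norm_mul_packetPair_le {s t : ℝ} {T : L2Sp d →L[ℂ] L2Sp d} {C : ℝ}
    (hT : FlowDecay s t T C) (hC : 0 ≤ C) {C₁ : ℝ} {p p₀ : Euc d × Euc d}
    {q : (Euc d × Euc d) × (Euc d × Euc d)}
    (h : ‖packetPair p q‖ ≤ C₁ * (wt (s / 2) (q.1.1 - p₀.1) * wt (s / 2) (q.2.1 - p₀.2))) :
    ‖inner ℂ (coh q.1) (T (coh q.2)) * packetPair p q‖ ≤ C * C₁ * phaseWeight s t p₀ q := by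
  rw [norm_mul]
  refine (mul_le_mul (hT q.2 q.1) h (norm_nonneg _) (mul_nonneg hC (wt_nonneg _ _))).trans_eq ?_
  rw [phaseWeight]
  ring

lemma FlowDecay.integrable_mul_packetPair {s t : ℝ} (hs : 2 * d < s) (ht : t ≠ 0)
    {T : L2Sp d →L[ℂ] L2Sp d} {C : ℝ} (hT : FlowDecay s t T C) (hC : 0 ≤ C) :
    ∃ K : ℝ, ∀ p, Integrable (fun q => inner ℂ (coh q.1) (T (coh q.2)) * packetPair p q) ∧
      ∫ q, ‖inner ℂ (coh q.1) (T (coh q.2)) * packetPair p q‖ ≤ K := by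
  have hs0 : 0 ≤ s / 2 := by
    have : (0 : ℝ) ≤ 2 * d := by positivity
    linarith
  obtain ⟨K, hK, h⟩ := exists_integral_phaseWeight_le (d := d) hs ht
  obtain ⟨C₁, hC₁, h1⟩ := norm_packetPair_le_wt (d := d) hs0
  refine ⟨C * C₁ * K, fun p => ?_⟩
  have hle := fun q => hT.norm_mul_packetPair_le hC (h1 p p (by simp) q)
  have hi := ((h p).1.const_mul (C * C₁)).mono' ((continuous_inner_coh_apply_coh T).mul
    (continuous_packetPair p)).aestronglyMeasurable (.of_forall hle)
  refine ⟨hi, (integral_mono hi.norm ((h p).1.const_mul _) hle).trans ?_⟩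
  rw [integral_const_mul]
  exact mul_le_mul_of_nonneg_left (h p).2 (mul_nonneg hC hC₁)

/-- Kernels of operators with flow decay are bounded and equicontinuous, uniformly in terms of
the decay constant. -/
lemma exists_opKernel_modulus {s t : ℝ} (hs : 2 * d < s) (ht : t ≠ 0) :
    ∃ K : ℝ, 0 ≤ K ∧ ∃ δ : Euc d × Euc d → Euc d × Euc d → ℝ,
      (∀ p₀, Tendsto (δ p₀) (𝓝 p₀) (𝓝 0)) ∧
      ∀ (T : L2Sp d →L[ℂ] L2Sp d) (C : ℝ), 0 ≤ C → FlowDecay s t T C →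
        (∀ p, ‖opKernel T p‖ ≤ C * K) ∧
        ∀ p₀ p, ‖p - p₀‖ ≤ 1 → ‖opKernel T p - opKernel T p₀‖ ≤ C * δ p₀ p := by
  have hs0 : 0 ≤ s / 2 := by
    have : (0 : ℝ) ≤ 2 * d := by positivity
    linarith
  obtain ⟨K, hK, h⟩ := exists_integral_phaseWeight_le (d := d) hs ht
  obtain ⟨C₁, hC₁, h1⟩ := norm_packetPair_le_wt (d := d) hs0
  have hω : Continuous fun q : (Euc d × Euc d) × (Euc d × Euc d) =>
      wt s (freeFlow (-t) q.1 - q.2) := by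
    have := continuous_wt (E := Euc d × Euc d) s
    unfold freeFlow
    fun_prop
  have hle : ∀ p₀ p : Euc d × Euc d, ‖p - p₀‖ ≤ 1 → ∀ q,
      ‖wt s (freeFlow (-t) q.1 - q.2) * ‖packetPair p q - packetPair p₀ q‖‖ ≤
        2 * C₁ * phaseWeight s t p₀ q := by
    intro p₀ p hp q
    rw [norm_mul, norm_norm, Real.norm_of_nonneg (wt_nonneg _ _), phaseWeight, mul_left_comm]
    refine mul_le_mul_of_nonneg_left ((norm_sub_le _ _).trans ?_) (wt_nonneg _ _)
    linarith [h1 p p₀ hp q, h1 p₀ p₀ (by simp) q]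
  have hmeas : ∀ p₀ p : Euc d × Euc d, Continuous fun q =>
      wt s (freeFlow (-t) q.1 - q.2) * ‖packetPair p q - packetPair p₀ q‖ := fun p₀ p =>
    hω.mul ((continuous_packetPair p).sub (continuous_packetPair p₀)).norm
  refine ⟨C₁ * K, mul_nonneg hC₁ hK, fun p₀ p =>
    ∫ q, wt s (freeFlow (-t) q.1 - q.2) * ‖packetPair p q - packetPair p₀ q‖, fun p₀ => ?_,
    fun T C hC hT => ⟨fun p => ?_, fun p₀ p hp => ?_⟩⟩
  · have hc : ContinuousAt (fun p => ∫ q, wt s (freeFlow (-t) q.1 - q.2) *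
        ‖packetPair p q - packetPair p₀ q‖) p₀ := by
      refine continuousAt_of_dominated (bound := fun q => 2 * C₁ * phaseWeight s t p₀ q)
        (.of_forall fun p => (hmeas p₀ p).aestronglyMeasurable) ?_ ((h p₀).1.const_mul _)
        (.of_forall fun q => ?_)
      · filter_upwards [Metric.closedBall_mem_nhds p₀ one_pos] with p hp
        exact .of_forall (hle p₀ p (by rwa [mem_closedBall_iff_norm] at hp))
      · exact (continuous_const.mul ((continuous_packetPair_uncurry.comp
          (Continuous.prodMk_left q)).sub continuous_const).norm).continuousAt
    simpa [ContinuousAt] using hc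
  · refine (norm_integral_le_of_norm_le ((h p).1.const_mul (C * C₁)) (.of_forall fun q =>
      hT.norm_mul_packetPair_le hC (h1 p p (by simp) q))).trans ?_
    rw [integral_const_mul, ← mul_assoc]
    exact mul_le_mul_of_nonneg_left (h p).2 (mul_nonneg hC hC₁)
  · obtain ⟨K', hK'⟩ := hT.integrable_mul_packetPair hs ht hC
    rw [opKernel, opKernel, ← integral_sub (hK' p).1 (hK' p₀).1, ← integral_const_mul]
    refine norm_integral_le_of_norm_le ((((h p₀).1.const_mul (2 * C₁)).mono'
      (hmeas p₀ p).aestronglyMeasurable (.of_forall (hle p₀ p hp))).const_mul C)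
      (.of_forall fun q => ?_)
    rw [← mul_sub, norm_mul, ← mul_assoc]
    exact mul_le_mul_of_nonneg_right (hT q.2 q.1) (norm_nonneg _)

lemma FlowDecay.continuous_opKernel {s t : ℝ} (hs : 2 * d < s) (ht : t ≠ 0)
    {T : L2Sp d →L[ℂ] L2Sp d} {C : ℝ} (hT : FlowDecay s t T C) (hC : 0 ≤ C) :
    Continuous (opKernel T) := by
  obtain ⟨K, -, δ, hδ, h⟩ := exists_opKernel_modulus (d := d) hs ht
  rw [continuous_iff_continuousAt]
  intro p₀
  rw [ContinuousAt, tendsto_iff_norm_sub_tendsto_zero]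
  refine squeeze_zero' (.of_forall fun p => norm_nonneg _) ?_
    (by simpa using (hδ p₀).const_mul C)
  filter_upwards [Metric.closedBall_mem_nhds p₀ one_pos] with p hp
  exact (h T C hC hT).2 p₀ p (by rwa [mem_closedBall_iff_norm] at hp)

section Representation

lemma integrable_mul_of_integral_norm_le {X Y : Type*} [MeasurableSpace X] [MeasurableSpace Y]
    {μ : Measure X} {ν : Measure Y} [SFinite μ] [SFinite ν] {Φ : X → ℂ} (hΦ : Integrable Φ μ)
    {k : X → Y → ℂ} (hk : AEStronglyMeasurable (fun r : X × Y => k r.1 r.2) (μ.prod ν)) {K : ℝ}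
    (hK : ∀ x, Integrable (k x) ν ∧ ∫ y, ‖k x y‖ ∂ν ≤ K) :
    Integrable (fun r : X × Y => Φ r.1 * k r.1 r.2) (μ.prod ν) := by
  have hm : AEStronglyMeasurable (fun r : X × Y => Φ r.1 * k r.1 r.2) (μ.prod ν) :=
    hΦ.aestronglyMeasurable.comp_fst.mul hk
  rw [integrable_prod_iff hm]
  refine ⟨.of_forall fun x => (hK x).1.const_mul (Φ x), (hΦ.norm.mul_const K).mono'
    hm.norm.integral_prod_right' (.of_forall fun x => ?_)⟩
  simp_rw [norm_mul (Φ x), integral_const_mul]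
  rw [norm_mul, norm_norm]
  refine mul_le_mul_of_nonneg_left ?_ (norm_nonneg _)
  rw [Real.norm_of_nonneg (integral_nonneg fun y => norm_nonneg _)]
  exact (hK x).2

variable (F : L2Sp d ≃ₗᵢ[ℂ] L2Sp d)
    (hF : ∀ f : L2Sp d, Integrable (f : Euc d → ℂ) →
      (F f : Euc d → ℂ) =ᵐ[volume] fun ξ =>
        ∫ x, Complex.exp (-(((2 * π * ⟪ξ, x⟫ : ℝ) : ℂ) * Complex.I)) * f x)

include hF in
lemma FlowDecay.inner_apply_eq {s t : ℝ} (hs : 2 * d < s) (ht : t ≠ 0)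
    {T : L2Sp d →L[ℂ] L2Sp d} {C : ℝ} (hT : FlowDecay s t T C) (hC : 0 ≤ C)
    {h f : L2Sp d} (hh : Integrable (h : Euc d → ℂ)) (hf : Integrable (f : Euc d → ℂ)) :
    inner ℂ h (T f) = ∫ p : Euc d × Euc d, (starRingEnd ℂ) (h p.1) * f p.2 * opKernel T p := by
  obtain ⟨K, hK⟩ := hT.integrable_mul_packetPair hs ht hC
  set N : (Euc d × Euc d) × (Euc d × Euc d) → ℂ := fun q => inner ℂ (coh q.1) (T (coh q.2)) with hN
  have hNc : Continuous N := continuous_inner_coh_apply_coh T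
  set Φ : Euc d × Euc d → ℂ := fun p => (starRingEnd ℂ) (h p.1) * f p.2 with hΦ
  have hΦi : Integrable Φ := Integrable.mul_prod
    (f := fun x => (starRingEnd ℂ) (h x)) ((RCLike.conjLIE (K := ℂ)).integrable_comp_iff.2 hh) hf
  have hint : Integrable (fun r : (Euc d × Euc d) × ((Euc d × Euc d) × (Euc d × Euc d)) =>
      Φ r.1 * (N r.2 * packetPair r.1 r.2)) (volume.prod volume) :=
    integrable_mul_of_integral_norm_le hΦi (k := fun p q => N q * packetPair p q)
      ((hNc.comp continuous_snd).mul continuous_packetPair_uncurry).aestronglyMeasurable hK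
  have e1 : ∀ q : (Euc d × Euc d) × (Euc d × Euc d),
      ∫ p : Euc d × Euc d, Φ p * (N q * packetPair p q) =
        inner ℂ h (coh q.1) * (N q * inner ℂ (coh q.2) f) := by
    intro q
    have e2 : ∀ p : Euc d × Euc d, Φ p * (N q * packetPair p q) =
        N q * (((starRingEnd ℂ) (h p.1) * packet (1 / 2) q.1 p.1) *
          (f p.2 * (starRingEnd ℂ) (packet (1 / 2) q.2 p.2))) := fun p => by
      simp only [hΦ, packetPair]
      ring
    simp_rw [e2]
    rw [integral_const_mul, Measure.volume_eq_prod, integral_prod_mul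
      (fun x => (starRingEnd ℂ) (h x) * packet (1 / 2) q.1 x)
      (fun y => f y * (starRingEnd ℂ) (packet (1 / 2) q.2 y)), ← inner_coh,
      ← inner_conj_symm h (coh q.1), inner_coh q.1 h, ← integral_conj]
    simp_rw [map_mul, Complex.conj_conj]
    ring
  have hswap : ∫ p : Euc d × Euc d, Φ p * opKernel T p =
      ∫ q : (Euc d × Euc d) × (Euc d × Euc d),
        inner ℂ h (coh q.1) * (N q * inner ℂ (coh q.2) f) := by
    simp_rw [← e1]
    rw [← integral_integral_swap hint]
    refine integral_congr_ae (.of_forall fun p => ?_)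
    simp only
    rw [integral_const_mul, opKernel]
  have hint2 := hint.integral_prod_right
  simp only [e1] at hint2
  rw [hswap, Measure.volume_eq_prod, integral_prod _ hint2, ← integral_inner_coh_mul F hF h (T f)]
  refine integral_congr_ae (.of_forall fun w => ?_)
  simp only
  rw [integral_const_mul]
  congr 1
  rw [← ContinuousLinearMap.adjoint_inner_left, ← integral_inner_coh_mul F hF]
  simp only [hN, ContinuousLinearMap.adjoint_inner_left]

include hF in
lemma FlowDecay.apply_ae {s t : ℝ} (hs : 2 * d < s) (ht : t ≠ 0)
    {T : L2Sp d →L[ℂ] L2Sp d} {C : ℝ} (hT : FlowDecay s t T C) (hC : 0 ≤ C)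
    {f : L2Sp d} (hf : Integrable (f : Euc d → ℂ)) :
    (T f : Euc d → ℂ) =ᵐ[volume] fun x => ∫ y, opKernel T (x, y) * f y := by
  obtain ⟨K, hK, _, _, hker⟩ := exists_opKernel_modulus (d := d) hs ht
  have hb := (hker T C hC hT).1
  have hcont := hT.continuous_opKernel hs ht hC
  have hint : ∀ S : Set (Euc d), volume S < ⊤ →
      Integrable (fun p : Euc d × Euc d => opKernel T p * f p.2)
        ((volume.restrict S).prod volume) := by
    intro S hS
    have : IsFiniteMeasure (volume.restrict S) := ⟨by simpa using hS⟩
    exact (hf.comp_snd (volume.restrict S)).bdd_mul (c := C * K) hcont.aestronglyMeasurable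
      (.of_forall hb)
  refine ae_eq_of_forall_setIntegral_eq_of_sigmaFinite (fun S _ hS => ?_) (fun S _ hS => ?_)
    (fun S hSm hS => ?_)
  · have : IsFiniteMeasure (volume.restrict S) := ⟨by simpa using hS⟩
    exact ((Lp.memLp (T f)).restrict S).integrable (by norm_num)
  · exact (hint S hS).integral_prod_left
  · set χ : L2Sp d := indicatorConstLp 2 hSm hS.ne (1 : ℂ) with hχ
    have hχae : (χ : Euc d → ℂ) =ᵐ[volume] S.indicator fun _ => (1 : ℂ) :=
      indicatorConstLp_coeFn
    have hχi : Integrable (χ : Euc d → ℂ) :=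
      ((integrable_indicator_iff hSm).2 (integrableOn_const hS.ne)).congr hχae.symm
    rw [← L2.inner_indicatorConstLp_one (𝕜 := ℂ) hSm hS.ne (T f),
      hT.inner_apply_eq F hF hs ht hC hχi hf]
    have e : (fun p : Euc d × Euc d => (starRingEnd ℂ) (χ p.1) * f p.2 * opKernel T p) =ᵐ[volume]
        (S ×ˢ Set.univ).indicator fun p => opKernel T p * f p.2 := by
      filter_upwards [(Measure.quasiMeasurePreserving_fst (μ := (volume : Measure (Euc d)))
        (ν := (volume : Measure (Euc d)))).ae hχae] with p hp
      rw [hp]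
      by_cases hpS : p.1 ∈ S <;> simp [hpS, mul_comm]
    rw [integral_congr_ae e, integral_indicator (hSm.prod MeasurableSet.univ),
      Measure.volume_eq_prod, ← Measure.prod_restrict, Measure.restrict_univ,
      integral_prod _ (hint S hS)]

end Representation

end Kernel

section Modulation

variable {d : ℕ}

/-- The complex number of phase `a` and log-modulus `m`. -/
def phaseExp (a m : ℝ) : ℂ := Complex.exp ((a : ℂ) * Complex.I) * ((Real.exp m : ℝ) : ℂ)

lemma phaseExp_mul (a m a' m' : ℝ) :
    phaseExp a m * phaseExp a' m' = phaseExp (a + a') (m + m') := by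
  rw [phaseExp, phaseExp, phaseExp, mul_mul_mul_comm, ← Complex.exp_add, ← Complex.ofReal_mul,
    ← Real.exp_add, Complex.ofReal_add a a', add_mul]

lemma conj_phaseExp (a m : ℝ) : (starRingEnd ℂ) (phaseExp a m) = phaseExp (-a) m := by
  simp [phaseExp, ← Complex.exp_conj]

lemma norm_phaseExp (a m : ℝ) : ‖phaseExp a m‖ = Real.exp m := by
  rw [phaseExp, norm_mul, Complex.norm_exp_ofReal_mul_I, one_mul, Complex.norm_real,
    Real.norm_of_nonneg (Real.exp_pos _).le]

lemma phaseExp_zero_right (a : ℝ) : phaseExp a 0 = Complex.exp ((a : ℂ) * Complex.I) := by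
  simp [phaseExp]

lemma phaseExp_zero_left (m : ℝ) : phaseExp 0 m = ((Real.exp m : ℝ) : ℂ) := by
  simp [phaseExp]

lemma integral_phaseExp_gauss (X Y : Euc d) :
    ∫ k : Euc d, phaseExp (2 * π * ⟪k, Y⟫) (-(2 * π) * ‖k - X‖ ^ 2) =
      (((1 / 2 : ℝ) ^ ((d : ℝ) / 2) : ℝ) : ℂ) *
        phaseExp (2 * π * ⟪X, Y⟫) (-(π / 2) * ‖Y‖ ^ 2) := by
  have h2 : (0 : ℝ) < (((2 * π : ℝ) : ℂ)).re := by
    rw [Complex.ofReal_re]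
    positivity
  have h := GaussianFourier.integral_cexp_neg_mul_sq_norm_add h2 (2 * π * Complex.I) Y
  rw [finrank_euclideanSpace_fin] at h
  rw [← integral_add_right_eq_self _ X]
  have e : ∀ k : Euc d, phaseExp (2 * π * ⟪k + X, Y⟫) (-(2 * π) * ‖k + X - X‖ ^ 2) =
      phaseExp (2 * π * ⟪X, Y⟫) 0 *
        Complex.exp (-((2 * π : ℝ) : ℂ) * ‖k‖ ^ 2 + 2 * π * Complex.I * ⟪Y, k⟫) := by
    intro k
    rw [add_sub_cancel_right, inner_add_left, real_inner_comm k Y, phaseExp, phaseExp,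
      Real.exp_zero, Complex.ofReal_one, mul_one, Complex.ofReal_exp, ← Complex.exp_add,
      ← Complex.exp_add]
    congr 1
    push_cast
    ring
  simp_rw [e]
  rw [integral_const_mul, h, ← add_zero (2 * π * ⟪X, Y⟫), ← zero_add (-(π / 2) * ‖Y‖ ^ 2),
    ← phaseExp_mul, phaseExp_zero_left]
  have e1 : (π : ℂ) / ((2 * π : ℝ) : ℂ) = ((1 / 2 : ℝ) : ℂ) := by
    rw [← Complex.ofReal_div]
    congr 1
    field_simp
  have e2 : (2 * π * Complex.I) ^ 2 * (‖Y‖ : ℂ) ^ 2 / (4 * ((2 * π : ℝ) : ℂ)) =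
      ((-(π / 2) * ‖Y‖ ^ 2 : ℝ) : ℂ) := by
    have : (π : ℂ) ≠ 0 := by exact_mod_cast pi_ne_zero
    rw [mul_pow, Complex.I_sq]
    push_cast
    field_simp
    ring
  rw [e1, e2, Complex.ofReal_cpow (by norm_num), Complex.ofReal_exp]
  push_cast
  ring_nf

/-- A Gaussian wave packet multiplied by a quadratic phase. -/
def chirpPacket (σ a : ℝ) (z : Euc d × Euc d) (y : Euc d) : ℂ :=
  Complex.exp (-(((σ * ‖y‖ ^ 2 : ℝ) : ℂ) * Complex.I)) * packet a z y

lemma chirpPacket_eq (σ a : ℝ) (z : Euc d × Euc d) (y : Euc d) :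
    chirpPacket σ a z y = phaseExp (-(σ * ‖y‖ ^ 2) + 2 * π * ⟪z.2, y⟫) (-π * a * ‖y - z.1‖ ^ 2) := by
  rw [← zero_add (-π * a * ‖y - z.1‖ ^ 2), ← phaseExp_mul, phaseExp_zero_right, chirpPacket,
    Complex.ofReal_neg, neg_mul]
  rfl

lemma norm_chirpPacket (σ a : ℝ) (z : Euc d × Euc d) (y : Euc d) :
    ‖chirpPacket σ a z y‖ = Real.exp (-π * a * ‖y - z.1‖ ^ 2) := by
  rw [chirpPacket_eq, norm_phaseExp]

lemma continuous_chirpPacket (σ a : ℝ) (z : Euc d × Euc d) : Continuous (chirpPacket σ a z) := by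
  have := continuous_packet a z
  unfold chirpPacket
  fun_prop

lemma integrable_chirpPacket (σ : ℝ) {a : ℝ} (ha : 0 < a) (z : Euc d × Euc d) :
    Integrable (chirpPacket σ a z) :=
  (integrable_packet ha z).congr' (continuous_chirpPacket σ a z).aestronglyMeasurable
    (.of_forall fun y => by rw [norm_packet, norm_chirpPacket])

lemma memLp_chirpPacket (σ : ℝ) {a : ℝ} (ha : 0 < a) (z : Euc d × Euc d) :
    MemLp (chirpPacket σ a z) 2 :=
  (memLp_packet ha z).congr_norm (continuous_chirpPacket σ a z).aestronglyMeasurable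
    (.of_forall fun y => by rw [norm_packet, norm_chirpPacket])

lemma norm_inner_coh_chirpPacket_le {σ a s : ℝ} (ha : 0 < a) (hs : 0 ≤ s) :
    ∃ C : ℝ, 0 ≤ C ∧ ∀ z w : Euc d × Euc d,
      ‖inner ℂ (coh w) ((memLp_chirpPacket σ ha z).toLp)‖ ≤
        C * wt s (w - (z.1, z.2 - (σ / π) • z.1)) := by
  obtain ⟨C, hC, h⟩ := norm_integral_chirp_packet_le_wt (d := d) ha one_half_pos hs (abs_nonneg σ)
  refine ⟨C, hC, fun z w => ?_⟩
  rw [inner_coh]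
  have e : (fun y => ((memLp_chirpPacket σ ha z).toLp : Euc d → ℂ) y * (starRingEnd ℂ) (packet (1 / 2) w y))
      =ᵐ[volume] fun y => Complex.exp (-(((σ * ‖y‖ ^ 2 : ℝ) : ℂ) * Complex.I)) * packet a z y *
        (starRingEnd ℂ) (packet (1 / 2) w y) := by
    filter_upwards [(memLp_chirpPacket σ ha z).coeFn_toLp] with y hy
    rw [hy, chirpPacket]
  rw [integral_congr_ae e]
  refine (h σ le_rfl z w).trans_eq ?_
  congr 2
  ext1
  · rfl
  · simp only [Prod.snd_sub]
    abel

section Decay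

variable (F : L2Sp d ≃ₗᵢ[ℂ] L2Sp d)
    (hF : ∀ f : L2Sp d, Integrable (f : Euc d → ℂ) →
      (F f : Euc d → ℂ) =ᵐ[volume] fun ξ =>
        ∫ x, Complex.exp (-(((2 * π * ⟪ξ, x⟫ : ℝ) : ℂ) * Complex.I)) * f x)

include hF in
lemma FlowDecay.norm_inner_le_of_wt {s t : ℝ} (hs : 2 * d < s) {T : L2Sp d →L[ℂ] L2Sp d} {C : ℝ}
    (hT : FlowDecay s t T C) (hC : 0 ≤ C) {h f : L2Sp d} {z₀ w₀ : Euc d × Euc d} {C₁ C₂ : ℝ}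
    (hC₁ : 0 ≤ C₁) (hC₂ : 0 ≤ C₂) (h1 : ∀ a, ‖inner ℂ (coh a) f‖ ≤ C₁ * wt s (a - z₀))
    (h2 : ∀ a, ‖inner ℂ (coh a) h‖ ≤ C₂ * wt s (a - w₀)) :
    ‖inner ℂ h (T f)‖ ≤ C * C₁ * schurConst d s * (1 + 2 * π * |t|) ^ s * C₂ * schurConst d s *
      wt s (w₀ - freeFlow t z₀) := by
  have hs0 : 0 ≤ s := le_trans (by positivity) hs.le
  have hK := (schurConst_pos d s).le
  refine _root_.norm_inner_le_of_wt F hF hs (by positivity) (fun a => ?_) h2 hC₂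
  refine (norm_inner_coh_comp_le F hF hs T hC hC₁
    (fun z => (hT z a).trans_eq (by rw [wt_sub_comm])) h1).trans ?_
  rw [mul_assoc _ ((1 + 2 * π * |t|) ^ s)]
  refine mul_le_mul_of_nonneg_left ?_ (by positivity)
  have e : freeFlow (-t) a - z₀ = freeFlow (-t) (a - freeFlow t z₀) := by
    have := freeFlow_freeFlow_neg (-t) z₀
    rw [neg_neg] at this
    rw [freeFlow_sub, this]
  rw [e]
  exact wt_freeFlow_le hs0 (abs_neg t).le _

include hF in
lemma FlowDecay.inner_toLp_eq {s t : ℝ} (hs : 2 * d < s) (ht : t ≠ 0)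
    {T : L2Sp d →L[ℂ] L2Sp d} {C : ℝ} (hT : FlowDecay s t T C) (hC : 0 ≤ C)
    {h f : Euc d → ℂ} (hh : MemLp h 2) (hf : MemLp f 2) (hh1 : Integrable h)
    (hf1 : Integrable f) :
    inner ℂ hh.toLp (T hf.toLp) =
      ∫ p : Euc d × Euc d, (starRingEnd ℂ) (h p.1) * f p.2 * opKernel T p := by
  rw [hT.inner_apply_eq F hF hs ht hC (hh1.congr hh.coeFn_toLp.symm)
    (hf1.congr hf.coeFn_toLp.symm)]
  refine integral_congr_ae ?_
  filter_upwards [(Measure.quasiMeasurePreserving_fst (μ := (volume : Measure (Euc d)))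
    (ν := (volume : Measure (Euc d)))).ae hh.coeFn_toLp,
    (Measure.quasiMeasurePreserving_snd (μ := (volume : Measure (Euc d)))
    (ν := (volume : Measure (Euc d)))).ae hf.coeFn_toLp] with p h1 h2
  rw [h1, h2]

end Decay

end Modulation

section Amplitude

variable {d : ℕ}

lemma phaseExp_amplitude_eq {r b β δ : ℝ} (hr : r ≠ 0) (hb : b = 1 + 2 / r ^ 2)
    (hβ : b * β = 2 / r) (hδ : δ = π * (2 - b * β ^ 2)) (u ζ v : Euc d × Euc d) (k : Euc d) :
    phaseExp (-(2 * π * (⟪ζ.1, v.1⟫ + ⟪ζ.2, v.2⟫)) - π / r * ‖v.1 - v.2‖ ^ 2 -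
          2 * π * ⟪r⁻¹ • (v.1 - u.1), v.2 - u.2⟫)
        (-π * (‖v.1 - u.1‖ ^ 2 + ‖v.2 - u.2‖ ^ 2) + π / 2 * ‖v.2 - u.2‖ ^ 2) *
      phaseExp (2 * π * ⟪k, v.2 - u.2⟫) (-(2 * π) * ‖k - r⁻¹ • (v.1 - u.1)‖ ^ 2) =
    phaseExp (-(2 * π * ⟪k, u.2⟫) - 2 * π / r * ⟪u.1, u.2⟫) (-δ * ‖k‖ ^ 2) *
      ((starRingEnd ℂ) (chirpPacket (-(π / r)) b (u.1 + β • k, ζ.1 - r⁻¹ • u.2) v.1) *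
        chirpPacket (π / r) (1 / 2) (u.2, k - ζ.2 + r⁻¹ • u.1) v.2) := by
  rw [chirpPacket_eq, chirpPacket_eq, conj_phaseExp, phaseExp_mul, phaseExp_mul, phaseExp_mul]
  congr 1
  · simp only [norm_sub_sq_real, inner_sub_left, inner_sub_right, inner_add_left,
      real_inner_smul_left, real_inner_comm v.1 u.2]
    field_simp
    ring
  · have e : b * ‖v.1 - (u.1 + β • k)‖ ^ 2 = b * ‖v.1 - u.1‖ ^ 2 -
        2 * (b * β) * ⟪k, v.1 - u.1⟫ + b * β ^ 2 * ‖k‖ ^ 2 := by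
      rw [← sub_sub, norm_sub_sq_real (v.1 - u.1), real_inner_smul_right, norm_smul, mul_pow,
        Real.norm_eq_abs, sq_abs, real_inner_comm]
      ring
    have e' : ‖k - r⁻¹ • (v.1 - u.1)‖ ^ 2 =
        ‖k‖ ^ 2 - 2 / r * ⟪k, v.1 - u.1⟫ + (r ^ 2)⁻¹ * ‖v.1 - u.1‖ ^ 2 := by
      rw [norm_sub_sq_real, real_inner_smul_right, norm_smul, mul_pow, Real.norm_eq_abs, sq_abs,
        inv_pow]
      ring
    rw [mul_assoc (-π) b, e, e', hβ, hδ, hb]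
    ring

lemma amplitude_eq_integral {r b β δ : ℝ} (hr : r ≠ 0) (hb : b = 1 + 2 / r ^ 2)
    (hβ : b * β = 2 / r) (hδ : δ = π * (2 - b * β ^ 2)) (u ζ v : Euc d × Euc d) :
    phaseExp (-(2 * π * (⟪ζ.1, v.1⟫ + ⟪ζ.2, v.2⟫)) - π / r * ‖v.1 - v.2‖ ^ 2)
        (-π * (‖v.1 - u.1‖ ^ 2 + ‖v.2 - u.2‖ ^ 2)) =
      (((2 : ℝ) ^ ((d : ℝ) / 2) : ℝ) : ℂ) * ∫ k : Euc d,
        phaseExp (-(2 * π * ⟪k, u.2⟫) - 2 * π / r * ⟪u.1, u.2⟫) (-δ * ‖k‖ ^ 2) *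
        ((starRingEnd ℂ) (chirpPacket (-(π / r)) b (u.1 + β • k, ζ.1 - r⁻¹ • u.2) v.1) *
          chirpPacket (π / r) (1 / 2) (u.2, k - ζ.2 + r⁻¹ • u.1) v.2) := by
  simp_rw [← phaseExp_amplitude_eq hr hb hβ hδ]
  rw [integral_const_mul, integral_phaseExp_gauss, mul_left_comm (phaseExp _ _), ← mul_assoc,
    phaseExp_mul, ← Complex.ofReal_mul, ← Real.mul_rpow (by norm_num) (by norm_num)]
  norm_num

lemma integrable_exp_neg_mul_rpow {δ s : ℝ} (hδ : 0 < δ) (hs : d < s) :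
    Integrable fun k : Euc d => Real.exp (-δ * ‖k‖ ^ 2) * (1 + ‖k‖) ^ s := by
  have hs' : (Module.finrank ℝ (Euc d) : ℝ) < s := by rwa [finrank_euclideanSpace_fin]
  have hs0 : 0 ≤ s := (Nat.cast_nonneg _).trans hs.le
  refine ((integrable_wt volume hs').const_mul (Real.exp ((2 * s) ^ 2 / (4 * δ)))).mono' ?_
    (.of_forall fun k => ?_)
  · refine Continuous.aestronglyMeasurable (Continuous.mul (by fun_prop) ?_)
    exact (continuous_const.add continuous_norm).rpow_const fun k =>
      Or.inl (one_add_norm_pos k).ne'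
  · have hk := one_add_norm_pos k
    rw [Real.norm_of_nonneg (by positivity)]
    have := mul_le_mul_of_nonneg_right
      (exp_neg_mul_sq_le hδ (2 * s) (norm_nonneg k) (by positivity))
      (Real.rpow_nonneg hk.le s)
    refine this.trans_eq ?_
    rw [mul_assoc, ← Real.rpow_add hk, wt]
    congr 2
    ring

end Amplitude

section ModulationBound

variable {d : ℕ} (F : L2Sp d ≃ₗᵢ[ℂ] L2Sp d)
    (hF : ∀ f : L2Sp d, Integrable (f : Euc d → ℂ) →
      (F f : Euc d → ℂ) =ᵐ[volume] fun ξ =>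
        ∫ x, Complex.exp (-(((2 * π * ⟪ξ, x⟫ : ℝ) : ℂ) * Complex.I)) * f x)

lemma continuous_chirpPacket_uncurry (σ a : ℝ) :
    Continuous fun p : (Euc d × Euc d) × Euc d => chirpPacket σ a p.1 p.2 := by
  have := continuous_packet_uncurry (d := d) a
  unfold chirpPacket
  fun_prop

lemma integral_norm_chirpPacket (σ : ℝ) {a : ℝ} (ha : 0 < a) (z : Euc d × Euc d) :
    ∫ y, ‖chirpPacket σ a z y‖ = (1 / a) ^ ((d : ℝ) / 2) := by
  simp_rw [norm_chirpPacket]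
  exact integral_gauss ha z.1

lemma integrable_phaseExp_gauss {δ : ℝ} (hδ : 0 < δ) (u : Euc d) (c : ℝ) :
    Integrable fun k : Euc d => phaseExp (-(2 * π * ⟪k, u⟫) - c) (-δ * ‖k‖ ^ 2) := by
  have h := integrable_gauss (d := d) (a := δ / π) (by positivity) 0
  refine h.congr' (Continuous.aestronglyMeasurable ?_) (.of_forall fun k => ?_)
  · unfold phaseExp
    fun_prop
  · have : π ≠ 0 := pi_ne_zero
    rw [norm_phaseExp, Real.norm_of_nonneg (Real.exp_pos _).le, sub_zero]
    congr 2
    field_simp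

include hF in
lemma FlowDecay.integral_integral_mul_opKernel {s t : ℝ} (hs : 2 * d < s) (ht : t ≠ 0)
    {T : L2Sp d →L[ℂ] L2Sp d} {C : ℝ} (hT : FlowDecay s t T C) (hC : 0 ≤ C) {Φ : Euc d → ℂ}
    (hΦ : Integrable Φ) {h f : Euc d → Euc d → ℂ}
    (hhc : Continuous fun q : Euc d × Euc d => h q.1 q.2)
    (hfc : Continuous fun q : Euc d × Euc d => f q.1 q.2) (hh : ∀ k, MemLp (h k) 2)
    (hf : ∀ k, MemLp (f k) 2) {A B : ℝ} (hA : ∀ k, Integrable (h k) ∧ ∫ x, ‖h k x‖ = A)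
    (hB : ∀ k, Integrable (f k) ∧ ∫ y, ‖f k y‖ = B) :
    ∫ v : Euc d × Euc d, (∫ k, Φ k * ((starRingEnd ℂ) (h k v.1) * f k v.2)) * opKernel T v =
      ∫ k, Φ k * inner ℂ (hh k).toLp (T (hf k).toLp) := by
  obtain ⟨K, hK, _, _, hker⟩ := exists_opKernel_modulus (d := d) hs ht
  have hbd := (hker T C hC hT).1
  have hcont := hT.continuous_opKernel hs ht hC
  have hhf : ∀ k, Integrable fun v : Euc d × Euc d => (starRingEnd ℂ) (h k v.1) * f k v.2 :=
    fun k => Integrable.mul_prod (f := fun x => (starRingEnd ℂ) (h k x))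
      ((RCLike.conjLIE (K := ℂ)).integrable_comp_iff.2 (hA k).1) (hB k).1
  have hint : Integrable (fun q : Euc d × (Euc d × Euc d) =>
      Φ q.1 * ((starRingEnd ℂ) (h q.1 q.2.1) * f q.1 q.2.2 * opKernel T q.2))
      (volume.prod volume) := by
    refine integrable_mul_of_integral_norm_le hΦ
      (k := fun k v => (starRingEnd ℂ) (h k v.1) * f k v.2 * opKernel T v)
      (K := A * B * (C * K)) ?_ fun k => ?_
    · refine Continuous.aestronglyMeasurable (Continuous.mul (Continuous.mul
        (Complex.continuous_conj.comp (hhc.comp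
          (f := fun q : Euc d × (Euc d × Euc d) => (q.1, q.2.1)) (by fun_prop)))
        (hfc.comp (f := fun q : Euc d × (Euc d × Euc d) => (q.1, q.2.2)) (by fun_prop)))
        (hcont.comp continuous_snd))
    · have hi := (hhf k).mul_bdd (c := C * K) hcont.aestronglyMeasurable (.of_forall hbd)
      refine ⟨hi, (integral_mono hi.norm ((hhf k).norm.mul_const (C * K)) fun v => ?_).trans_eq ?_⟩
      · simp only
        rw [norm_mul]
        exact mul_le_mul_of_nonneg_left (hbd v) (norm_nonneg _)
      · simp_rw [norm_mul, RCLike.norm_conj]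
        rw [integral_mul_const, Measure.volume_eq_prod,
          integral_prod_mul (fun x => ‖h k x‖) (fun y => ‖f k y‖), (hA k).2, (hB k).2]
  have e : ∀ v : Euc d × Euc d,
      (∫ k, Φ k * ((starRingEnd ℂ) (h k v.1) * f k v.2)) * opKernel T v =
        ∫ k, Φ k * ((starRingEnd ℂ) (h k v.1) * f k v.2 * opKernel T v) := by
    intro v
    rw [← integral_mul_const]
    simp_rw [mul_assoc]
  simp_rw [e]
  rw [← integral_integral_swap hint]
  refine integral_congr_ae (.of_forall fun k => ?_)
  simp only
  rw [integral_const_mul, hT.inner_toLp_eq F hF hs ht hC _ _ (hA k).1 (hB k).1]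

include hF in
lemma FlowDecay.stft2_eq {s t : ℝ} (hs : 2 * d < s) (ht : t ≠ 0) {T : L2Sp d →L[ℂ] L2Sp d}
    {C : ℝ} (hT : FlowDecay s t T C) (hC : 0 ≤ C) {r b β δ : ℝ} (hr : r = 2 * π * t) (hb0 : 0 < b)
    (hb : b = 1 + 2 / r ^ 2) (hβ : b * β = 2 / r) (hδ0 : 0 < δ) (hδ : δ = π * (2 - b * β ^ 2))
    (u ζ : Euc d × Euc d) :
    STFT2 (fun p => Complex.exp (-(Complex.I * ((‖p.1 - p.2‖ ^ 2 / (2 * t) : ℝ) : ℂ))) *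
        opKernel T p) u ζ =
      (((2 : ℝ) ^ ((d : ℝ) / 2) : ℝ) : ℂ) * ∫ k : Euc d,
        phaseExp (-(2 * π * ⟪k, u.2⟫) - 2 * π / r * ⟪u.1, u.2⟫) (-δ * ‖k‖ ^ 2) *
          inner ℂ ((memLp_chirpPacket (-(π / r)) hb0 (u.1 + β • k, ζ.1 - r⁻¹ • u.2)).toLp)
            (T ((memLp_chirpPacket (π / r) one_half_pos
              (u.2, k - ζ.2 + r⁻¹ • u.1)).toLp)) := by
  have hr0 : r ≠ 0 := by
    have := pi_ne_zero
    simp [hr, ht]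
  have key := hT.integral_integral_mul_opKernel F hF hs ht hC
    (integrable_phaseExp_gauss hδ0 u.2 (2 * π / r * ⟪u.1, u.2⟫))
    ((continuous_chirpPacket_uncurry (-(π / r)) b).comp (f := fun q : Euc d × Euc d =>
      ((u.1 + β • q.1, ζ.1 - r⁻¹ • u.2), q.2)) (by fun_prop))
    ((continuous_chirpPacket_uncurry (π / r) (1 / 2)).comp (f := fun q : Euc d × Euc d =>
      ((u.2, q.1 - ζ.2 + r⁻¹ • u.1), q.2)) (by fun_prop))
    (fun k => memLp_chirpPacket (-(π / r)) hb0 (u.1 + β • k, ζ.1 - r⁻¹ • u.2))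
    (fun k => memLp_chirpPacket (π / r) one_half_pos (u.2, k - ζ.2 + r⁻¹ • u.1))
    (fun k => ⟨integrable_chirpPacket _ hb0 _, integral_norm_chirpPacket _ hb0 _⟩)
    (fun k => ⟨integrable_chirpPacket _ one_half_pos _,
      integral_norm_chirpPacket _ one_half_pos _⟩)
  refine Eq.trans ?_ (congrArg (fun c : ℂ => (((2 : ℝ) ^ ((d : ℝ) / 2) : ℝ) : ℂ) * c) key)
  rw [STFT2, ← integral_const_mul]
  refine integral_congr_ae (.of_forall fun v => ?_)
  have h1 := amplitude_eq_integral hr0 hb hβ hδ u ζ v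
  have h2 : π / r * ‖v.1 - v.2‖ ^ 2 = ‖v.1 - v.2‖ ^ 2 / (2 * t) := by
    have := pi_ne_zero
    rw [hr]
    field_simp
  refine Eq.trans ?_ (mul_assoc _ _ _)
  rw [← h1, h2]
  simp only [gaussWindow2, phaseExp, Prod.fst_sub, Prod.snd_sub]
  rw [Complex.ofReal_sub, sub_mul, sub_eq_add_neg (_ * Complex.I), Complex.exp_add, Complex.ofReal_neg, neg_mul,
    mul_comm Complex.I]
  ring_nf

end ModulationBound

section AmplitudeBound

variable {d : ℕ}

lemma wt_chirpPacket_center_sub_le {r β s t : ℝ} (hs : 0 ≤ s) (hr0 : r ≠ 0) (hr : r = 2 * π * t)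
    (hβ : |β / r - 1| ≤ 1) (u ζ : Euc d × Euc d) (k : Euc d) :
    wt s ((u.1 + β • k, ζ.1 - r⁻¹ • u.2 - (-(π / r) / π) • (u.1 + β • k)) -
      freeFlow t (u.2, k - ζ.2 + r⁻¹ • u.1 - (π / r / π) • u.2)) ≤
      ((1 + |r|⁻¹) * (1 + ‖k‖)) ^ s * wt s ζ := by
  have hπ : π ≠ 0 := pi_ne_zero
  have e : (u.1 + β • k, ζ.1 - r⁻¹ • u.2 - (-(π / r) / π) • (u.1 + β • k)) -
      freeFlow t (u.2, k - ζ.2 + r⁻¹ • u.1 - (π / r / π) • u.2) =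
      (r • ((β / r - 1) • k + ζ.2), ζ.1 + ζ.2 + (β / r - 1) • k) := by
    have e1 : π / r / π = r⁻¹ := by field_simp
    rw [neg_div, e1, freeFlow, ← hr]
    ext1 <;> simp only [Prod.fst_sub, Prod.snd_sub] <;> match_scalars <;> field_simp <;> ring
  rw [e]
  refine wt_le_of_le hs (mul_nonneg (by positivity) (one_add_norm_pos k).le) ?_
  set P := r • ((β / r - 1) • k + ζ.2) with hP
  set Q := ζ.1 + ζ.2 + (β / r - 1) • k with hQ
  have hPn : ‖P‖ ≤ ‖(P, Q)‖ := norm_fst_le (P, Q)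
  have hQn : ‖Q‖ ≤ ‖(P, Q)‖ := norm_snd_le (P, Q)
  have h2 : ζ.2 = r⁻¹ • P - (β / r - 1) • k := by
    rw [hP, inv_smul_smul₀ hr0]
    abel
  have h1 : ζ.1 = Q - r⁻¹ • P := by
    rw [hP, hQ, inv_smul_smul₀ hr0]
    abel
  have hk : ‖(β / r - 1) • k‖ ≤ ‖k‖ := by
    rw [norm_smul]
    exact mul_le_of_le_one_left (norm_nonneg _) hβ
  have hrP : ‖r⁻¹ • P‖ ≤ |r|⁻¹ * ‖(P, Q)‖ := by
    rw [norm_smul, norm_inv, Real.norm_eq_abs]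
    exact mul_le_mul_of_nonneg_left hPn (by positivity)
  have h3 : ‖ζ‖ ≤ ‖k‖ + (1 + |r|⁻¹) * ‖(P, Q)‖ := by
    refine norm_prod_le_iff.2 ⟨?_, ?_⟩
    · rw [h1]
      linarith [norm_sub_le Q (r⁻¹ • P), norm_nonneg k]
    · rw [h2]
      linarith [norm_sub_le (r⁻¹ • P) ((β / r - 1) • k), norm_nonneg (P, Q)]
  have h4 : 0 ≤ |r|⁻¹ := by positivity
  have h5 := mul_nonneg h4 (norm_nonneg k)
  have h6 := mul_nonneg (mul_nonneg h4 (norm_nonneg k)) (norm_nonneg (P, Q))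
  have h7 := mul_nonneg (norm_nonneg k) (norm_nonneg (P, Q))
  nlinarith

lemma one_add_sq_add_sq_rpow_le {s : ℝ} (hs : 0 ≤ s) (ζ : Euc d × Euc d) :
    (1 + (‖ζ.1‖ ^ 2 + ‖ζ.2‖ ^ 2)) ^ (s / 2) ≤ 2 ^ (s / 2) * (1 + ‖ζ‖) ^ s := by
  have h1 : 1 + (‖ζ.1‖ ^ 2 + ‖ζ.2‖ ^ 2) ≤ 2 * (1 + ‖ζ‖) ^ 2 := by
    have h1 := pow_le_pow_left₀ (norm_nonneg _) (norm_fst_le ζ) 2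
    have h2 := pow_le_pow_left₀ (norm_nonneg _) (norm_snd_le ζ) 2
    nlinarith [norm_nonneg ζ]
  refine (Real.rpow_le_rpow (by positivity) h1 (by positivity)).trans_eq ?_
  rw [Real.mul_rpow two_pos.le (by positivity), ← Real.rpow_natCast (1 + ‖ζ‖),
    ← Real.rpow_mul (one_add_norm_pos ζ).le]
  congr 2
  push_cast
  ring

lemma exists_stft2_le (F : L2Sp d ≃ₗᵢ[ℂ] L2Sp d)
    (hF : ∀ f : L2Sp d, Integrable (f : Euc d → ℂ) →
      (F f : Euc d → ℂ) =ᵐ[volume] fun ξ =>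
        ∫ x, Complex.exp (-(((2 * π * ⟪ξ, x⟫ : ℝ) : ℂ) * Complex.I)) * f x)
    {s t : ℝ} (hs : 2 * d < s) (ht : t ≠ 0) {C : ℝ} (hC : 0 ≤ C) :
    ∃ K : ℝ, ∀ T : L2Sp d →L[ℂ] L2Sp d, FlowDecay s t T C → ∀ u ζ : Euc d × Euc d,
      (1 + (‖ζ.1‖ ^ 2 + ‖ζ.2‖ ^ 2)) ^ (s / 2) *
        ‖STFT2 (fun p => Complex.exp (-(Complex.I * ((‖p.1 - p.2‖ ^ 2 / (2 * t) : ℝ) : ℂ))) *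
          opKernel T p) u ζ‖ ≤ K := by
  have hd0 : (0 : ℝ) ≤ d := Nat.cast_nonneg d
  have hs0 : 0 ≤ s := by linarith
  obtain ⟨r, hr⟩ : ∃ r, r = 2 * π * t := ⟨_, rfl⟩
  have hr0 : r ≠ 0 := by
    have := pi_ne_zero
    simp [hr, ht]
  have hr2 : 0 < r ^ 2 := by positivity
  obtain ⟨b, hb⟩ : ∃ b, b = 1 + 2 / r ^ 2 := ⟨_, rfl⟩
  have hb0 : 0 < b := by
    rw [hb]
    positivity
  obtain ⟨β, hβ⟩ : ∃ β, b * β = 2 / r := ⟨2 / r / b, by field_simp⟩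
  have hβr : β / r = 2 / (r ^ 2 + 2) := by
    have h1 : β * (r ^ 2 + 2) = 2 * r := by
      rw [hb] at hβ
      field_simp at hβ
      linarith
    rw [div_eq_div_iff hr0 (by positivity), h1]
  have hβr1 : β / r < 1 := by
    rw [hβr, div_lt_one (by positivity)]
    linarith
  have hβr0 : 0 ≤ β / r := by
    rw [hβr]
    positivity
  obtain ⟨δ, hδ⟩ : ∃ δ, δ = π * (2 - b * β ^ 2) := ⟨_, rfl⟩
  have hδ0 : 0 < δ := by
    have : b * β ^ 2 = 2 * (β / r) := by
      rw [sq, ← mul_assoc, hβ]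
      ring
    rw [hδ, this]
    exact mul_pos pi_pos (by linarith)
  obtain ⟨A₁, hA₁, h1⟩ := norm_inner_coh_chirpPacket_le (d := d) (σ := π / r) one_half_pos hs0
  obtain ⟨A₂, hA₂, h2⟩ := norm_inner_coh_chirpPacket_le (d := d) (σ := -(π / r)) hb0 hs0
  obtain ⟨B, hB⟩ : ∃ B, B = C * A₁ * schurConst d s * (1 + 2 * π * |t|) ^ s * A₂ *
    schurConst d s := ⟨_, rfl⟩
  have hB0 : 0 ≤ B := by
    have := schurConst_pos d s
    rw [hB]
    positivity
  have hint := integrable_exp_neg_mul_rpow (d := d) hδ0 (s := s) (by linarith)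
  refine ⟨2 ^ (s / 2) * (2 ^ ((d : ℝ) / 2) * (B * (1 + |r|⁻¹) ^ s *
    ∫ k : Euc d, Real.exp (-δ * ‖k‖ ^ 2) * (1 + ‖k‖) ^ s)), fun T hT u ζ => ?_⟩
  have hle : ‖STFT2 (fun p => Complex.exp (-(Complex.I *
      ((‖p.1 - p.2‖ ^ 2 / (2 * t) : ℝ) : ℂ))) * opKernel T p) u ζ‖ ≤ 2 ^ ((d : ℝ) / 2) *
      (B * (1 + |r|⁻¹) ^ s * ∫ k : Euc d, Real.exp (-δ * ‖k‖ ^ 2) * (1 + ‖k‖) ^ s) * wt s ζ := by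
    rw [hT.stft2_eq F hF hs ht hC hr hb0 hb hβ hδ0 hδ u ζ, norm_mul, Complex.norm_real,
      Real.norm_of_nonneg (by positivity), mul_assoc]
    refine mul_le_mul_of_nonneg_left ?_ (by positivity)
    rw [mul_right_comm, ← integral_const_mul]
    refine norm_integral_le_of_norm_le (hint.const_mul _) (.of_forall fun k => ?_)
    have h3 := hT.norm_inner_le_of_wt F hF hs hC hA₁ hA₂
      (h1 (u.2, k - ζ.2 + r⁻¹ • u.1)) (h2 (u.1 + β • k, ζ.1 - r⁻¹ • u.2))
    rw [← hB] at h3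
    have h4 := h3.trans (mul_le_mul_of_nonneg_left
      (wt_chirpPacket_center_sub_le hs0 hr0 hr (by rw [abs_le]; constructor <;> linarith) u ζ k) hB0)
    rw [norm_mul, norm_phaseExp]
    refine (mul_le_mul_of_nonneg_left h4 (Real.exp_pos _).le).trans_eq ?_
    rw [Real.mul_rpow (by positivity) (one_add_norm_pos k).le]
    ring
  have hζ := one_add_norm_pos ζ
  have hcancel : (1 + ‖ζ‖) ^ s * wt s ζ = 1 := by
    rw [wt, ← Real.rpow_add hζ, add_neg_cancel, Real.rpow_zero]
  refine (mul_le_mul (one_add_sq_add_sq_rpow_le hs0 ζ) hle (norm_nonneg _)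
    (by positivity)).trans_eq ?_
  rw [mul_mul_mul_comm, hcancel, mul_one]

end AmplitudeBound

section Limit

variable {d : ℕ} {s t C : ℝ} {T : ℕ → L2Sp d →L[ℂ] L2Sp d} {S : L2Sp d →L[ℂ] L2Sp d}

lemma FlowDecay.of_tendsto (hTS : ∀ f, Tendsto (fun n => T n f) atTop (𝓝 (S f)))
    (hT : ∀ᶠ n in atTop, FlowDecay s t (T n) C) : FlowDecay s t S C := fun z w =>
  le_of_tendsto (((tendsto_const_nhds (x := coh w)).inner (hTS (coh z))).norm)
    (hT.mono fun _ hn => hn z w)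

lemma tendsto_opKernel (hs : 2 * d < s) (ht : t ≠ 0) (hC : 0 ≤ C)
    (hTS : ∀ f, Tendsto (fun n => T n f) atTop (𝓝 (S f)))
    (hT : ∀ᶠ n in atTop, FlowDecay s t (T n) C) (p : Euc d × Euc d) :
    Tendsto (fun n => opKernel (T n) p) atTop (𝓝 (opKernel S p)) := by
  have hs0 : 0 ≤ s / 2 := by
    have : (0 : ℝ) ≤ 2 * d := by positivity
    linarith
  obtain ⟨K, hK, h⟩ := exists_integral_phaseWeight_le (d := d) hs ht
  obtain ⟨C₁, hC₁, h1⟩ := norm_packetPair_le_wt (d := d) hs0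
  refine tendsto_integral_filter_of_dominated_convergence _ (.of_forall fun n =>
    ((continuous_inner_coh_apply_coh (T n)).mul (continuous_packetPair p)).aestronglyMeasurable)
    (hT.mono fun n hn => .of_forall fun q => hn.norm_mul_packetPair_le hC (h1 p p (by simp) q))
    ((h p).1.const_mul (C * C₁)) (.of_forall fun q => ?_)
  exact ((tendsto_const_nhds (x := coh q.1)).inner (hTS (coh q.2))).mul_const _

lemma tendstoUniformlyOn_opKernel (hs : 2 * d < s) (ht : t ≠ 0) (hC : 0 ≤ C)
    (hTS : ∀ f, Tendsto (fun n => T n f) atTop (𝓝 (S f)))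
    (hT : ∀ᶠ n in atTop, FlowDecay s t (T n) C) {K : Set (Euc d × Euc d)} (hK : IsCompact K) :
    TendstoUniformlyOn (fun n => opKernel (T n)) (opKernel S) atTop K := by
  rw [← tendstoLocallyUniformlyOn_iff_tendstoUniformlyOn_of_compact hK,
    Metric.tendstoLocallyUniformlyOn_iff]
  intro ε hε p₀ _
  obtain ⟨_, _, δ, hδ, h⟩ := exists_opKernel_modulus (d := d) hs ht
  have h1 : ∀ᶠ p in 𝓝 p₀, C * δ p₀ p < ε / 3 :=
    ((hδ p₀).const_mul C).eventually_lt_const (by simpa using by positivity)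
  refine ⟨{p | C * δ p₀ p < ε / 3} ∩ Metric.closedBall p₀ 1,
    mem_nhdsWithin_of_mem_nhds (inter_mem h1 (Metric.closedBall_mem_nhds p₀ one_pos)), ?_⟩
  have h2 := (tendsto_opKernel hs ht hC hTS hT p₀).eventually
    (Metric.ball_mem_nhds _ (show 0 < ε / 3 by positivity))
  filter_upwards [hT, h2] with n hn hn2 p hp
  have hp1 : ‖p - p₀‖ ≤ 1 := mem_closedBall_iff_norm.1 hp.2
  have h3 := (h (T n) C hC hn).2 p₀ p hp1
  have h4 := (h S C hC (FlowDecay.of_tendsto hTS hT)).2 p₀ p hp1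
  rw [← dist_eq_norm] at h3 h4
  rw [dist_comm] at hn2
  have h5 := dist_triangle4 (opKernel S p) (opKernel S p₀) (opKernel (T n) p₀) (opKernel (T n) p)
  rw [dist_comm (opKernel (T n) p₀)] at h5
  have h6 : C * δ p₀ p < ε / 3 := hp.1
  linarith

lemma exists_trotter_limit (F : L2Sp d ≃ₗᵢ[ℂ] L2Sp d) (U₀ : ℝ → L2Sp d →L[ℂ] L2Sp d)
    (hU₀ : ∀ (τ : ℝ) (f : L2Sp d),
      (F (U₀ τ f) : Euc d → ℂ) =ᵐ[volume] fun ξ =>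
        Complex.exp (-(((2 * π ^ 2 * τ * ‖ξ‖ ^ 2 : ℝ) : ℂ) * Complex.I)) *
          (F f : Euc d → ℂ) ξ)
    {V : Euc d → ℝ} {Mul : ℝ → L2Sp d →L[ℂ] L2Sp d}
    (hMul : ∀ (τ : ℝ) (f : L2Sp d),
      (Mul τ f : Euc d → ℂ) =ᵐ[volume] fun x =>
        Complex.exp (-(((τ * V x : ℝ) : ℂ) * Complex.I)) * f x)
    (hVcont : Continuous V) {M : ℝ} (hM : ∀ x, |V x| ≤ M) (ht : t ≠ 0) :
    ∃ S : L2Sp d →L[ℂ] L2Sp d, ∀ f, Tendsto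
      (fun n : ℕ => (((U₀ (t / n)).comp (Mul (t / n))) ^ n) f) atTop (𝓝 (S f)) := by
  obtain ⟨A, hA⟩ := exists_potentialOp hVcont hM
  have hlim : ∀ f : L2Sp d, ∃ ψ, Tendsto
      (fun n : ℕ => (((U₀ (t / n)).comp (Mul (t / n))) ^ n) f) atTop (𝓝 ψ) :=
    trotter_tendsto (free_zero F U₀ hU₀) (free_add F U₀ hU₀) (norm_free F U₀ hU₀)
      (continuous_free F U₀ hU₀) ((-Complex.I) • A) (norm_mulExp_le hMul)
      (C := 3 * M ^ 2) (by positivity) ht fun τ _ f => by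
        have h := norm_add_smul_potential_sub_mulExp_le hA hMul hM τ f
        have e : (τ : ℂ) • (((-Complex.I) • A) f) = (-(τ * Complex.I) : ℂ) • A f := by
          rw [smul_apply, smul_smul, mul_neg]
        rwa [← e] at h
  choose U hU using hlim
  exact ⟨continuousLinearMapOfTendsto (fun n : ℕ => ((U₀ (t / n)).comp (Mul (t / n))) ^ n)
    (tendsto_pi_nhds.2 hU), hU⟩

lemma FlowDecay.kernel_limit (F : L2Sp d ≃ₗᵢ[ℂ] L2Sp d)
    (hF : ∀ f : L2Sp d, Integrable (f : Euc d → ℂ) →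
      (F f : Euc d → ℂ) =ᵐ[volume] fun ξ =>
        ∫ x, Complex.exp (-(((2 * π * ⟪ξ, x⟫ : ℝ) : ℂ) * Complex.I)) * f x)
    (hs : 2 * d < s) (ht : t ≠ 0) (hC : 0 ≤ C) (hTd : ∀ n : ℕ, 1 ≤ n → FlowDecay s t (T n) C)
    (hS : ∀ f, Tendsto (fun n => T n f) atTop (𝓝 (S f)))
    (ι : SchwartzMap (Euc d) ℂ → L2Sp d)
    (hι : ∀ φ : SchwartzMap (Euc d) ℂ, (ι φ : Euc d → ℂ) =ᵐ[volume] fun x => φ x) :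
    ∃ (e : ℕ → Euc d → Euc d → ℂ) (u : Euc d → Euc d → ℂ),
      (∀ n : ℕ, 1 ≤ n → Continuous fun p : Euc d × Euc d => e n p.1 p.2) ∧
      (∀ n : ℕ, 1 ≤ n → ∀ φ : SchwartzMap (Euc d) ℂ,
        (T n (ι φ) : Euc d → ℂ) =ᵐ[volume]
          fun x => ∫ y, e n x y * φ y) ∧
      (∃ C : ℝ, ∀ n : ℕ, 1 ≤ n → ∀ u' ζ : Euc d × Euc d,
        (1 + (‖ζ.1‖ ^ 2 + ‖ζ.2‖ ^ 2)) ^ (s / 2) *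
          ‖STFT2 (fun p : Euc d × Euc d =>
            Complex.exp (-(Complex.I * ((‖p.1 - p.2‖ ^ 2 / (2 * t) : ℝ) : ℂ))) *
              e n p.1 p.2) u' ζ‖ ≤ C) ∧
      Continuous (fun p : Euc d × Euc d => u p.1 p.2) ∧
      (∃ M : ℝ, ∀ x y : Euc d, ‖u x y‖ ≤ M) ∧
      (∀ K : Set (Euc d × Euc d), IsCompact K →
        TendstoUniformlyOn (fun (n : ℕ) (p : Euc d × Euc d) => e n p.1 p.2)
          (fun p => u p.1 p.2) atTop K) ∧
      (∀ φ : SchwartzMap (Euc d) ℂ,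
        ∃ ψ : L2Sp d,
          Tendsto (fun n : ℕ => T n (ι φ))
            atTop (𝓝 ψ) ∧
          (ψ : Euc d → ℂ) =ᵐ[volume] fun x => ∫ y, u x y * φ y) := by
  have hTe : ∀ᶠ n in atTop, FlowDecay s t (T n) C := (eventually_ge_atTop 1).mono hTd
  have hSd : FlowDecay s t S C := FlowDecay.of_tendsto hS hTe
  have hker : ∀ R : L2Sp d →L[ℂ] L2Sp d, FlowDecay s t R C → ∀ φ : SchwartzMap (Euc d) ℂ,
      (R (ι φ) : Euc d → ℂ) =ᵐ[volume] fun x => ∫ y, opKernel R (x, y) * φ y := by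
    intro R hR φ
    refine (hR.apply_ae F hF hs ht hC (φ.integrable.congr (hι φ).symm)).trans
      (.of_forall fun x => integral_congr_ae ?_)
    filter_upwards [hι φ] with y hy
    rw [hy]
  obtain ⟨K, hK⟩ := exists_stft2_le F hF hs ht hC
  obtain ⟨K', _, _, _, hbound⟩ := exists_opKernel_modulus (d := d) hs ht
  exact ⟨fun n x y => opKernel (T n) (x, y), fun x y => opKernel S (x, y),
    fun n hn => (hTd n hn).continuous_opKernel hs ht hC, fun n hn => hker _ (hTd n hn),
    ⟨K, fun n hn => hK _ (hTd n hn)⟩, hSd.continuous_opKernel hs ht hC,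
    ⟨C * K', fun x y => (hbound S C hC hSd).1 (x, y)⟩,
    fun _ hcpt => tendstoUniformlyOn_opKernel hs ht hC hS hTe hcpt,
    fun φ => ⟨S (ι φ), hS (ι φ), hker S hSd φ⟩⟩

end Limit

/-- **Pointwise convergence of integral kernels of Trotter approximations of Feynman
path integrals, for potentials in `M^∞_s(ℝ^d)`, `s > 2d`** (Nicola–Trapasso): for
`t ≠ 0` the Trotter approximations `E_n(t) = (U₀(t/n) M_{t/n})^n` have continuous
integral kernels `e_n`; the amplitudes `a_n(x,y) = e^{-i|x-y|²/(2t)} e_n(x,y)` form a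
bounded subset of `M^∞_s(ℝ^{2d})`; and `e_n` converges uniformly on compact subsets to
a continuous function of bounded modulus `u_t`, the integral kernel of the propagator
`U(t) = lim_n E_n(t)`. Here `F` is the Fourier–Plancherel transform, `U₀` the free
propagator, `Mul` multiplication by `e^{-iτV}`, and `ι` the embedding `𝓢 ↪ L²`. -/
theorem trotter_kernels_pointwise_convergence_Minfty_s
    {d : ℕ} (hd : 1 ≤ d) (s : ℝ) (hs : 2 * d < s)
    (V : Euc d → ℝ) (hVcont : Continuous V) (hVbdd : ∃ M : ℝ, ∀ x, |V x| ≤ M)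
    (hVmod : ∃ C : ℝ, ∀ x ξ : Euc d,
      (1 + ‖ξ‖ ^ 2) ^ (s / 2) * ‖STFT (fun x => (V x : ℂ)) x ξ‖ ≤ C)
    (F : L2Sp d ≃ₗᵢ[ℂ] L2Sp d)
    (hF : ∀ f : L2Sp d, Integrable (f : Euc d → ℂ) →
      (F f : Euc d → ℂ) =ᵐ[volume] fun ξ =>
        ∫ x, Complex.exp (-(((2 * π * ⟪ξ, x⟫ : ℝ) : ℂ) * Complex.I)) * f x)
    (U₀ : ℝ → L2Sp d →L[ℂ] L2Sp d)
    (hU₀ : ∀ (τ : ℝ) (f : L2Sp d),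
      (F (U₀ τ f) : Euc d → ℂ) =ᵐ[volume] fun ξ =>
        Complex.exp (-(((2 * π ^ 2 * τ * ‖ξ‖ ^ 2 : ℝ) : ℂ) * Complex.I)) *
          (F f : Euc d → ℂ) ξ)
    (Mul : ℝ → L2Sp d →L[ℂ] L2Sp d)
    (hMul : ∀ (τ : ℝ) (f : L2Sp d),
      (Mul τ f : Euc d → ℂ) =ᵐ[volume] fun x =>
        Complex.exp (-(((τ * V x : ℝ) : ℂ) * Complex.I)) * f x)
    (ι : SchwartzMap (Euc d) ℂ → L2Sp d)
    (hι : ∀ φ : SchwartzMap (Euc d) ℂ, (ι φ : Euc d → ℂ) =ᵐ[volume] fun x => φ x)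
    (t : ℝ) (ht : t ≠ 0) :
    ∃ (e : ℕ → Euc d → Euc d → ℂ) (u : Euc d → Euc d → ℂ),
      (∀ n : ℕ, 1 ≤ n → Continuous fun p : Euc d × Euc d => e n p.1 p.2) ∧
      (∀ n : ℕ, 1 ≤ n → ∀ φ : SchwartzMap (Euc d) ℂ,
        ((((U₀ (t / n)).comp (Mul (t / n))) ^ n) (ι φ) : Euc d → ℂ) =ᵐ[volume]
          fun x => ∫ y, e n x y * φ y) ∧
      (∃ C : ℝ, ∀ n : ℕ, 1 ≤ n → ∀ u' ζ : Euc d × Euc d,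
        (1 + (‖ζ.1‖ ^ 2 + ‖ζ.2‖ ^ 2)) ^ (s / 2) *
          ‖STFT2 (fun p : Euc d × Euc d =>
            Complex.exp (-(Complex.I * ((‖p.1 - p.2‖ ^ 2 / (2 * t) : ℝ) : ℂ))) *
              e n p.1 p.2) u' ζ‖ ≤ C) ∧
      Continuous (fun p : Euc d × Euc d => u p.1 p.2) ∧
      (∃ M : ℝ, ∀ x y : Euc d, ‖u x y‖ ≤ M) ∧
      (∀ K : Set (Euc d × Euc d), IsCompact K →
        TendstoUniformlyOn (fun (n : ℕ) (p : Euc d × Euc d) => e n p.1 p.2)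
          (fun p => u p.1 p.2) atTop K) ∧
      (∀ φ : SchwartzMap (Euc d) ℂ,
        ∃ ψ : L2Sp d,
          Tendsto (fun n : ℕ => (((U₀ (t / n)).comp (Mul (t / n))) ^ n) (ι φ))
            atTop (𝓝 ψ) ∧
          (ψ : Euc d → ℂ) =ᵐ[volume] fun x => ∫ y, u x y * φ y) := by
  obtain ⟨M, hM⟩ := hVbdd
  obtain ⟨C, hC, hdecay⟩ := trotter_matrix_bound F hF U₀ hU₀ hMul hs hVcont hM hVmod t
  obtain ⟨S, hS⟩ := exists_trotter_limit F U₀ hU₀ hMul hVcont hM ht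
  exact FlowDecay.kernel_limit F hF hs ht hC hdecay hS ι hι
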